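/- arXiv:1808.06980 — 3 statements merged into one kernel-verified Lean document; each statement's English description precedes it below -/
import Mathlib

section
/- For the d-dimensional depolarizing channel Δ^p(ρ) = (1−p)ρ + p π, the channel entropy is H(Δ^p) = −(1−p+p/d²)log₂(1−p+p/d²) − (d²−1)(p/d²)log₂(p/d²) − log₂ d. -/
open Matrix BigOperators
open scoped Kronecker ComplexOrder

namespace QCh

variable {n m : Type*} [Fintype n] [DecidableEq n] [Fintype m] [DecidableEq m]

/-- Density matrix: positive semidefinite with unit trace. -/
def IsDensity (ρ : Matrix n n ℂ) : Prop := ρ.PosSemidef ∧ ρ.trace = 1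

/-- Pure state: density matrix that is a projection. -/
def IsPure (ρ : Matrix n n ℂ) : Prop := IsDensity ρ ∧ ρ * ρ = ρ

/-- Apply a real function to a Hermitian matrix via its spectral decomposition. -/
noncomputable def matFun (f : ℝ → ℝ) (A : Matrix n n ℂ) : Matrix n n ℂ :=
  if h : A.IsHermitian then
    (h.eigenvectorUnitary : Matrix n n ℂ) * Matrix.diagonal (fun i => (f (h.eigenvalues i) : ℂ)) *
      (star h.eigenvectorUnitary : Matrix n n ℂ)
  else 0

/-- von Neumann entropy in bits. -/
noncomputable def vnEntropy (ρ : Matrix n n ℂ) : ℝ :=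
  if h : ρ.IsHermitian then -∑ i, h.eigenvalues i * Real.logb 2 (h.eigenvalues i) else 0

/-- Base-2 matrix logarithm (on the support, via spectral calculus). -/
noncomputable def matLog2 (A : Matrix n n ℂ) : Matrix n n ℂ := matFun (Real.logb 2) A

/-- Quantum relative entropy in bits. -/
noncomputable def relEnt (ρ σ : Matrix n n ℂ) : ℝ :=
  ((ρ * (matLog2 ρ - matLog2 σ)).trace).re

/-- Partial trace over the second tensor factor. -/
noncomputable def ptR {p : Type*} [Fintype p] (M : Matrix (n × p) (n × p) ℂ) : Matrix n n ℂ :=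
  Matrix.of fun i j => ∑ k, M (i, k) (j, k)

/-- Partial trace over the first tensor factor. -/
noncomputable def ptL {p : Type*} [Fintype p] (M : Matrix (p × n) (p × n) ℂ) : Matrix n n ℂ :=
  Matrix.of fun i j => ∑ k, M (k, i) (k, j)

/-- Conditional entropy H(B|R) of a state on R ⊗ B. -/
noncomputable def condEntB {R B : Type*} [Fintype R] [DecidableEq R] [Fintype B] [DecidableEq B]
    (ω : Matrix (R × B) (R × B) ℂ) : ℝ := vnEntropy ω - vnEntropy (ptR ω)

/-- Extension id_R ⊗ N of a map N on system A, acting on a state of R ⊗ A. -/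
noncomputable def ext {R A B : Type*} [Fintype R] [DecidableEq R] [Fintype A] [DecidableEq A]
    [Fintype B] [DecidableEq B] (N : Matrix A A ℂ → Matrix B B ℂ)
    (ψ : Matrix (R × A) (R × A) ℂ) : Matrix (R × B) (R × B) ℂ :=
  Matrix.of fun p q => N (Matrix.of fun a a' => ψ (p.1, a) (q.1, a')) p.2 q.2

/-- The channel with Kraus operators K. -/
noncomputable def krausMap {A B ι : Type*} [Fintype A] [Fintype B] [Fintype ι]
    (K : ι → Matrix B A ℂ) (X : Matrix A A ℂ) : Matrix B B ℂ :=
  ∑ i, K i * X * (K i)ᴴ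

/-- Entropy of a channel: infimum of H(B|R) of the output over pure bipartite inputs,
with the reference system isomorphic to the channel input. -/
noncomputable def chEnt {A B : Type*} [Fintype A] [DecidableEq A] [Fintype B] [DecidableEq B]
    (N : Matrix A A ℂ → Matrix B B ℂ) : ℝ :=
  sInf {x | ∃ ψ : Matrix (A × A) (A × A) ℂ, IsPure ψ ∧ x = condEntB (ext N ψ)}

/-- The d-dimensional depolarizing channel Δ^p(ρ) = (1−p)ρ + p Tr(ρ) π with π = I/d. -/
noncomputable def depolarizingCh (d : ℕ) (p : ℝ) (ρ : Matrix (Fin d) (Fin d) ℂ) :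
    Matrix (Fin d) (Fin d) ℂ :=
  ((1 - p : ℝ) : ℂ) • ρ + ((p : ℝ) : ℂ) • (ρ.trace • ((d : ℂ)⁻¹ • (1 : Matrix (Fin d) (Fin d) ℂ)))

section Aux
set_option linter.unusedSectionVars false
open scoped MatrixOrder Matrix.Norms.L2Operator

/-- Real part of the trace. -/
noncomputable def rtr (A : Matrix n n ℂ) : ℝ := A.trace.re

lemma rtr_add (A B : Matrix n n ℂ) : rtr (A + B) = rtr A + rtr B := by simp [rtr]
lemma rtr_sub (A B : Matrix n n ℂ) : rtr (A - B) = rtr A - rtr B := by simp [rtr]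
lemma rtr_smul (c : ℝ) (A : Matrix n n ℂ) : rtr (c • A) = c * rtr A := by
  simp [rtr, Matrix.trace_smul]

lemma rtr_cfc {A : Matrix n n ℂ} (hA : A.IsHermitian) (f : ℝ → ℝ) :
    rtr (cfc f A) = ∑ i, f (hA.eigenvalues i) := by
  rw [hA.cfc_eq, rtr, Matrix.IsHermitian.cfc, Unitary.conjStarAlgAut_apply, Matrix.trace_mul_cycle]
  simp [Matrix.trace]

lemma vnEntropy_eq {A : Matrix n n ℂ} (hA : A.IsHermitian) :
    vnEntropy A = rtr (cfc Real.negMulLog A) / Real.log 2 := by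
  rw [rtr_cfc hA, vnEntropy, dif_pos hA, Finset.sum_div, ← Finset.sum_neg_distrib]
  refine Finset.sum_congr rfl fun i _ => ?_
  simp [Real.negMulLog, Real.logb]; ring

lemma continuous_rtr : Continuous (rtr (n := n)) := by
  unfold rtr
  exact Complex.continuous_re.comp (Continuous.matrix_trace continuous_id)

/-- Continuity of the entropy along curves of Hermitian matrices. -/
lemma continuous_ent {X : Type*} [TopologicalSpace X] (A : X → Matrix n n ℂ) (hA : Continuous A)
    (h : ∀ x, (A x).IsHermitian) : Continuous fun x => rtr (cfc Real.negMulLog (A x)) := by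
  refine continuous_rtr.comp ?_
  exact Continuous.cfc_of_mem_nhdsSet (s := Set.univ) (p := IsSelfAdjoint) Real.negMulLog Filter.univ_mem hA
    (fun x => h x) Real.continuous_negMulLog.continuousOn

lemma rtr_cfc_mul_cfc {A B : Matrix n n ℂ} (hA : A.IsHermitian) (hB : B.IsHermitian) :
    ∃ w : n → n → ℝ, (∀ i j, 0 ≤ w i j) ∧ ∀ f g : ℝ → ℝ,
    rtr (cfc f A * cfc g B) = ∑ i, ∑ j, w i j * (f (hA.eigenvalues i) * g (hB.eigenvalues j)) := by
  set W : Matrix n n ℂ := star (hA.eigenvectorUnitary : Matrix n n ℂ) * hB.eigenvectorUnitary with hW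
  refine ⟨fun i j => Complex.normSq (W i j), fun i j => Complex.normSq_nonneg _, fun f g => ?_⟩
  rw [hA.cfc_eq, hB.cfc_eq, rtr, Matrix.IsHermitian.cfc, Matrix.IsHermitian.cfc,
    Unitary.conjStarAlgAut_apply, Unitary.conjStarAlgAut_apply]
  set U : Matrix n n ℂ := (hA.eigenvectorUnitary : Matrix n n ℂ)
  set V : Matrix n n ℂ := (hB.eigenvectorUnitary : Matrix n n ℂ)
  set D := diagonal (RCLike.ofReal ∘ f ∘ hA.eigenvalues : n → ℂ)
  set E := diagonal (RCLike.ofReal ∘ g ∘ hB.eigenvalues : n → ℂ)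
  have : (U * D * star U * (V * E * star V)).trace = (D * W * E * star W).trace := by
    rw [hW, star_mul, star_star]
    have : U * D * star U * (V * E * star V) = U * (D * star U * (V * E * star V)) := by
      simp only [mul_assoc]
    rw [this, Matrix.trace_mul_comm]
    simp only [mul_assoc]
  rw [this]
  simp only [Matrix.trace, Matrix.diag, Matrix.mul_apply (M := D * W * E), Complex.re_sum]
  refine Finset.sum_congr rfl fun i _ => Finset.sum_congr rfl fun j _ => ?_
  simp only [D, E, Matrix.mul_diagonal, Matrix.diagonal_mul, Matrix.star_apply, Function.comp]
  have : ((RCLike.ofReal (f (hA.eigenvalues i)) : ℂ) * W i j * (RCLike.ofReal (g (hB.eigenvalues j)) : ℂ) * star (W i j))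
     = ((Complex.normSq (W i j) * (f (hA.eigenvalues i) * g (hB.eigenvalues j)) : ℝ) : ℂ) := by
    push_cast
    rw [Complex.normSq_eq_conj_mul_self]
    simp only [RCLike.star_def]
    simp
    ring
  rw [this, Complex.ofReal_re]

/-- Klein's inequality. -/
lemma klein {A B : Matrix n n ℂ} (hA : A.PosDef) (hB : B.PosDef) :
    rtr (A * CFC.log B) + (rtr A - rtr B) ≤ - rtr (cfc Real.negMulLog A) := by
  obtain ⟨w, hw, h⟩ := rtr_cfc_mul_cfc hA.isHermitian hB.isHermitian
  have sA : IsSelfAdjoint A := hA.isHermitian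
  have sB : IsSelfAdjoint B := hB.isHermitian
  have h1 := h id Real.log
  have h2 := h id 1
  have h3 := h 1 id
  have h4 := h Real.negMulLog 1
  rw [cfc_id ℝ A] at h1 h2
  rw [cfc_one ℝ B] at h2 h4
  rw [cfc_one ℝ A, cfc_id ℝ B] at h3
  simp only [mul_one, one_mul, Pi.one_apply, id] at h1 h2 h3 h4
  rw [CFC.log, h1, h2, h3, h4, ← sub_nonneg]
  simp only [← Finset.sum_sub_distrib, ← Finset.sum_neg_distrib, ← Finset.sum_add_distrib]
  refine Finset.sum_nonneg fun i _ => Finset.sum_nonneg fun j _ => ?_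
  have ha := hA.eigenvalues_pos i
  have hb := hB.eigenvalues_pos j
  set a := hA.isHermitian.eigenvalues i
  set b := hB.isHermitian.eigenvalues j
  have hl : Real.log b - Real.log a ≤ b / a - 1 := by
    rw [← Real.log_div hb.ne' ha.ne']
    exact Real.log_le_sub_one_of_pos (by positivity)
  have : a * (Real.log b - Real.log a) ≤ b - a := by
    calc _ ≤ a * (b / a - 1) := by gcongr
      _ = _ := by field_simp
  have := mul_nonneg (hw i j) (sub_nonneg.2 this)
  simp only [Real.negMulLog]
  linarith

/-- The embedding `X ↦ X ⊗ 1`. -/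
noncomputable def kr (m : Type*) [Fintype m] [DecidableEq m] :
    Matrix n n ℂ →⋆ₐ[ℝ] Matrix (n × m) (n × m) ℂ where
  toFun X := X ⊗ₖ (1 : Matrix m m ℂ)
  map_one' := by simp
  map_mul' X Y := by rw [← Matrix.mul_kronecker_mul, one_mul]
  map_zero' := by simp
  map_add' X Y := by rw [Matrix.add_kronecker]
  commutes' r := by
    ext ⟨i, k⟩ ⟨j, l⟩
    simp [Matrix.algebraMap_matrix_apply, Matrix.one_apply, Matrix.kroneckerMap_apply]
    by_cases h : i = j <;> by_cases h' : k = l <;> simp [h, h']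
  map_star' X := by
    simp [Matrix.star_eq_conjTranspose, Matrix.conjTranspose_kronecker]

lemma kr_apply (X : Matrix n n ℂ) (i j : n) (k l : m) :
    kr m X (i, k) (j, l) = if k = l then X i j else 0 := by
  change (X ⊗ₖ (1 : Matrix m m ℂ)) (i, k) (j, l) = _
  simp [Matrix.kroneckerMap_apply, Matrix.one_apply]

lemma kr_cfc {X : Matrix n n ℂ} (hX : X.IsHermitian) (f : ℝ → ℝ) :
    cfc f (kr m X) = kr m (cfc f X) := by
  have h1 : IsSelfAdjoint X := hX
  symm
  refine StarAlgHom.map_cfc (kr m) f X ?_ ?_ h1 (h1.map _)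
  · exact (Matrix.finite_real_spectrum (A := X)).continuousOn _
  · exact LinearMap.continuous_of_finiteDimensional ((kr m).toAlgHom.toLinearMap : Matrix n n ℂ →ₗ[ℝ] Matrix (n × m) (n × m) ℂ)

lemma rtr_kr (X : Matrix n n ℂ) : rtr (kr m X) = Fintype.card m * rtr X := by
  simp [rtr, Matrix.trace, Fintype.sum_prod_type, kr_apply, Finset.mul_sum]

lemma rtr_mul_kr (ψ : Matrix (n × m) (n × m) ℂ) (X : Matrix n n ℂ) :
    rtr (ψ * kr m X) = rtr (ptR ψ * X) := by
  simp only [rtr, Matrix.trace, Matrix.diag, Matrix.mul_apply, Fintype.sum_prod_type, kr_apply, ptR, Matrix.of_apply]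
  congr 1
  refine Finset.sum_congr rfl fun i _ => ?_
  simp only [mul_ite, mul_zero, Finset.sum_ite_eq', Finset.mem_univ, if_true, Finset.sum_mul]
  rw [Finset.sum_comm]

lemma ptR_herm {ψ : Matrix (n × m) (n × m) ℂ} (h : ψ.IsHermitian) : (ptR ψ).IsHermitian := by
  ext i j
  simp only [Matrix.conjTranspose_apply, ptR, Matrix.of_apply, star_sum]
  exact Finset.sum_congr rfl fun k _ => h.apply _ _

/-- `1 ⊗ |k⟩⟨l|` -/
noncomputable def ek (k l : m) : Matrix (n × m) (n × m) ℂ := (1 : Matrix n n ℂ) ⊗ₖ Matrix.single k l (1 : ℂ)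

lemma ek_conj (ψ : Matrix (n × m) (n × m) ℂ) (k l k' l' : m) (i j : n) (r s : m) :
    ((ek k l : Matrix (n × m) (n × m) ℂ) * ψ * (ek k' l' : Matrix (n × m) (n × m) ℂ)ᴴ) (i, r) (j, s) = if r = k ∧ s = k' then ψ (i, l) (j, l') else 0 := by
  simp only [ek, Matrix.mul_apply, Fintype.sum_prod_type, Matrix.kroneckerMap_apply, Matrix.one_apply,
    Matrix.single_apply, Matrix.conjTranspose_apply]
  by_cases h1 : r = k <;> by_cases h2 : s = k' <;>
    simp [h1, h2, ite_and, eq_comm, apply_ite (starRingEnd ℂ)] <;> grind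

lemma psi_le {ψ : Matrix (n × m) (n × m) ℂ} (h : ψ.PosSemidef) :
    ψ ≤ (Fintype.card m : ℝ) • kr m (ptR ψ) := by
  rw [Matrix.le_iff]
  have key : (Fintype.card m : ℝ) • kr m (ptR ψ) - ψ =
     (1/2 : ℝ) • (∑ k : m, ∑ l : m, (ek k k - ek l l) * ψ * (ek k k - ek l l)ᴴ)
      + (Fintype.card m : ℝ) • ∑ k : m, ∑ l : m, if k = l then 0 else ek k l * ψ * (ek k l)ᴴ := by
    ext ⟨i, r⟩ ⟨j, s⟩
    simp only [Matrix.conjTranspose_sub, sub_mul, mul_sub, Matrix.add_apply, Matrix.sub_apply, Matrix.smul_apply, Matrix.sum_apply,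
      kr_apply, ek_conj, apply_ite (fun M : Matrix (n × m) (n × m) ℂ => M (i, r) (j, s)), Matrix.zero_apply, ptR, Matrix.of_apply]
    set g : m → m → ℂ := fun a b => ψ (i, a) (j, b) with hg
    change (Fintype.card m : ℝ) • (if r = s then ∑ k, g k k else 0) - g r s = _
    have e1 : ∀ k l : m, ψ (i, k) (j, l) = g k l := fun _ _ => rfl
    simp only [e1, ite_and, Finset.sum_sub_distrib, Finset.sum_ite_eq, Finset.mem_univ, if_true,
      Finset.sum_const, Finset.card_univ]
    by_cases hrs : r = s
    · subst hrs
      have e2 : ∀ k, (∑ l, if k = l then 0 else if r = k then if r = k then g l l else 0 else 0)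
          = if r = k then (∑ l, g l l) - g r r else 0 := by
        intro k
        by_cases h : r = k
        · subst h
          simp only [if_true]
          rw [eq_sub_iff_add_eq, ← Finset.sum_erase_add _ _ (Finset.mem_univ r),
            ← Finset.sum_erase_add (f := fun l => g l l) (a := r) (h := Finset.mem_univ r)]
          simp only [if_true, add_zero]
          congr 1
          refine Finset.sum_congr rfl fun l hl => ?_
          rw [if_neg (Finset.ne_of_mem_erase hl).symm]
        · simp [h]
      simp only [e2, Finset.sum_ite_eq, Finset.mem_univ, if_true]
      simp [Finset.sum_ite_eq]
      ring
    · have e3 : ∀ k (x : ℂ), (if r = k then if s = k then x else 0 else 0) = 0 := by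
        intro k x
        split_ifs with h1 h2
        · exact absurd (h1.trans h2.symm) hrs
        · rfl
        · rfl
      simp [e3, hrs, Ne.symm hrs]
      ring
  rw [key]
  refine .add (.smul (Matrix.posSemidef_sum _ fun k _ => Matrix.posSemidef_sum _ fun l _ => ?_) (by norm_num))
     (.smul (Matrix.posSemidef_sum _ fun k _ => Matrix.posSemidef_sum _ fun l _ => ?_) (by positivity))
  · exact h.mul_mul_conjTranspose_same _
  · split_ifs
    · exact .zero
    · exact h.mul_mul_conjTranspose_same _

lemma rtr_mul_mono {A X Y : Matrix n n ℂ} (hA : A.PosSemidef) (h : X ≤ Y) :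
    rtr (A * X) ≤ rtr (A * Y) := by
  rw [Matrix.le_iff] at h
  obtain ⟨B, hB⟩ := CStarAlgebra.nonneg_iff_eq_star_mul_self.1 hA.nonneg
  rw [Matrix.star_eq_conjTranspose] at hB
  subst hB
  have h1 := (h.mul_mul_conjTranspose_same B).trace_nonneg
  have h2 : (B * (Y - X) * Bᴴ).trace = (Bᴴ * B * Y).trace - (Bᴴ * B * X).trace := by
    rw [Matrix.trace_mul_comm, ← mul_assoc, mul_sub, Matrix.trace_sub]
  rw [h2] at h1
  have := (Complex.le_def.1 h1).1
  simp only [Complex.zero_re, Complex.sub_re] at this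
  exact sub_nonneg.1 this

/-- `a ψ + b ψ_R ⊗ 1` -/
noncomputable def om (ψ : Matrix (n × m) (n × m) ℂ) (a b : ℝ) : Matrix (n × m) (n × m) ℂ :=
  a • ψ + b • kr m (ptR ψ)

lemma kr_posDef [Nonempty m] {ψ : Matrix (n × m) (n × m) ℂ} (h : ψ.PosDef) :
    (kr m (ptR ψ)).PosDef := by
  have h1 := psi_le h.posSemidef
  have h2 := (h.isStrictlyPositive.of_le h1).posDef
  have hN : (0 : ℝ) < Fintype.card m := by exact_mod_cast Fintype.card_pos
  have := h2.smul (inv_pos.2 hN)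
  rwa [smul_smul, inv_mul_cancel₀ hN.ne', one_smul] at this

lemma om_posDef [Nonempty m] {ψ : Matrix (n × m) (n × m) ℂ} (h : ψ.PosDef) {a b : ℝ} (ha : 0 ≤ a)
    (hb : 0 < b) : (om ψ a b).PosDef :=
  Matrix.PosDef.posSemidef_add (h.posSemidef.smul ha) ((kr_posDef h).smul hb)

lemma rtr_ptR (ψ : Matrix (n × m) (n × m) ℂ) : rtr (ptR ψ) = rtr ψ := by
  simp [rtr, Matrix.trace, ptR, Fintype.sum_prod_type]

lemma rtr_om (ψ : Matrix (n × m) (n × m) ℂ) (h : rtr ψ = 1) (a b : ℝ) :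
    rtr (om ψ a b) = a + b * Fintype.card m := by
  rw [om, rtr_add, rtr_smul, rtr_smul, rtr_kr, rtr_ptR, h]; ring

lemma mul_log_eq {A : Matrix n n ℂ} (h : A.IsHermitian) :
    A * CFC.log A = - cfc Real.negMulLog A := by
  have h1 : IsSelfAdjoint A := h
  conv_lhs => rw [← cfc_id ℝ A]
  rw [CFC.log, cfc_id ℝ A]
  nth_rw 1 [← cfc_id ℝ A]
  rw [← cfc_mul _ _ A (Matrix.finite_real_spectrum.continuousOn _) (Matrix.finite_real_spectrum.continuousOn _),
    ← cfc_neg]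
  congr 1
  ext x
  simp [Real.negMulLog]

lemma step [Nonempty m] {ψ : Matrix (n × m) (n × m) ℂ} (h : ψ.PosDef) (ht : rtr ψ = 1) {b x y : ℝ}
    (hb : 0 < b) (hx : 0 ≤ x) (hxy : x ≤ y) :
    - rtr (cfc Real.negMulLog (om ψ y b)) - - rtr (cfc Real.negMulLog (om ψ x b)) ≤
      (y - x) * (Real.log (y * Fintype.card m + b) - rtr (cfc Real.negMulLog (ptR ψ)) + 1) := by
  have hN : (0 : ℝ) < Fintype.card m := by exact_mod_cast Fintype.card_pos
  have hy : 0 ≤ y := hx.trans hxy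
  have px := om_posDef h hx hb
  have py := om_posDef h hy hb
  have k := klein px py
  rw [rtr_om _ ht, rtr_om _ ht] at k
  have hK := kr_posDef h
  have e1 : - rtr (cfc Real.negMulLog (om ψ y b)) = rtr (om ψ y b * CFC.log (om ψ y b)) := by
    rw [mul_log_eq py.isHermitian]; simp [rtr]
  have e2 : om ψ y b = om ψ x b + (y - x) • ψ := by
    rw [om, om, sub_smul]; abel
  have e3 : om ψ y b * CFC.log (om ψ y b) = om ψ x b * CFC.log (om ψ y b) +
      (y - x) • (ψ * CFC.log (om ψ y b)) := by
    nth_rw 1 [e2]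
    rw [add_mul, smul_mul_assoc]
  have hle : om ψ y b ≤ (y * Fintype.card m + b) • kr m (ptR ψ) := by
    rw [om, add_smul, mul_smul]
    gcongr
    exact psi_le h.posSemidef
  have hlog := CFC.log_le_log hle py.isStrictlyPositive
  rw [CFC.log_smul' _ (by positivity) hK.isStrictlyPositive] at hlog
  have h5 := rtr_mul_mono h.posSemidef hlog
  have e4 : rtr (ψ * (algebraMap ℝ _ (Real.log (y * Fintype.card m + b)) + CFC.log (kr m (ptR ψ)))) =
      Real.log (y * Fintype.card m + b) - rtr (cfc Real.negMulLog (ptR ψ)) := by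
    have hρ := ptR_herm h.isHermitian
    rw [mul_add, rtr_add, CFC.log, kr_cfc hρ, rtr_mul_kr, ← CFC.log, mul_log_eq hρ,
      Algebra.algebraMap_eq_smul_one, mul_smul_comm, mul_one, rtr_smul, ht]
    simp [rtr]; ring
  rw [e4] at h5
  rw [e1, e3, rtr_add, rtr_smul]
  have := mul_le_mul_of_nonneg_left h5 (sub_nonneg.2 hxy)
  linarith

lemma telescoping {F : ℝ → ℝ} {C : ℝ} (hC : 0 ≤ C)
    (h : ∀ x y, 0 ≤ x → x ≤ y → F y - F x ≤ C * (y - x) ^ 2) {a : ℝ} (ha : 0 ≤ a) : F a ≤ F 0 := by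
  refine le_of_forall_pos_le_add fun ε hε => ?_
  obtain ⟨N, hN⟩ := exists_nat_gt (C * a ^ 2 / ε)
  have hN0 : (0 : ℝ) < N := lt_of_le_of_lt (by positivity) hN
  have key : ∀ k : ℕ, F (k * (a / N)) ≤ F 0 + k * (C * (a / N) ^ 2) := by
    intro k
    induction k with
    | zero => simp
    | succ k ih =>
      have hq : 0 ≤ a / N := by positivity
      have := h (k * (a / N)) ((k + 1 : ℕ) * (a / N)) (by positivity) (by push_cast; nlinarith)
      have e : ((k + 1 : ℕ) : ℝ) * (a / N) - k * (a / N) = a / N := by push_cast; ring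
      rw [e] at this
      push_cast at *
      linarith
  have h1 := key N
  have e1 : (N : ℝ) * (a / N) = a := by field_simp
  have e2 : (N : ℝ) * (C * (a / N) ^ 2) = C * a ^ 2 / N := by field_simp
  rw [e1, e2] at h1
  have : C * a ^ 2 / N ≤ ε := by
    rw [div_lt_iff₀ hε] at hN
    rw [div_le_iff₀ hN0]; linarith
  linarith

lemma core [Nonempty m] {ψ : Matrix (n × m) (n × m) ℂ} (h : ψ.PosDef) (ht : rtr ψ = 1) {a b N : ℝ}
    (hNd : N = Fintype.card m) (hb : 0 < b) (ha : 0 ≤ a) :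
    N * Real.negMulLog b + (N * b + a) * rtr (cfc Real.negMulLog (ptR ψ))
      + (Real.negMulLog (a * N + b) - Real.negMulLog b) / N ≤
      rtr (cfc Real.negMulLog (om ψ a b)) := by
  have hN : 0 < N := by rw [hNd]; exact_mod_cast Fintype.card_pos
  set H := rtr (cfc Real.negMulLog (ptR ψ)) with hH
  have main := telescoping (F := fun x => - rtr (cfc Real.negMulLog (om ψ x b)) + x * H
    + Real.negMulLog (x * N + b) / N) (C := N / b) (by positivity) ?_ ha
  · have e0 : rtr (cfc Real.negMulLog (om ψ 0 b)) = N * Real.negMulLog b + N * b * H := by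
      have hρ := ptR_herm h.isHermitian
      have hK : IsSelfAdjoint (kr m (ptR ψ)) := (kr_posDef h).isHermitian
      rw [om, zero_smul, zero_add, ← cfc_comp_const_mul b Real.negMulLog _ (Real.continuous_negMulLog.continuousOn) hK]
      have : (fun x => Real.negMulLog (b * x)) = fun x => Real.negMulLog b * id x + b * Real.negMulLog x := by
        ext x; rw [Real.negMulLog_mul]; simp; ring
      rw [this, cfc_add _ _ _ (Matrix.finite_real_spectrum.continuousOn _) (Matrix.finite_real_spectrum.continuousOn _),
        cfc_const_mul _ _ _ (Matrix.finite_real_spectrum.continuousOn _),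
        cfc_const_mul _ _ _ (Matrix.finite_real_spectrum.continuousOn _), cfc_id ℝ _, kr_cfc hρ, rtr_add, rtr_smul,
        rtr_smul, rtr_kr, rtr_kr, rtr_ptR, ht, ← hNd, ← hH]
      ring
    simp only [e0, zero_mul, zero_add, add_zero] at main
    have := sub_div (Real.negMulLog (a * N + b)) (Real.negMulLog b) N
    linarith
  · intro x y hx hxy
    have hs := step h ht hb hx hxy
    rw [← hNd, ← hH] at hs
    have hX : 0 < x * N + b := by positivity
    have hy := hx.trans hxy
    have hY : 0 < y * N + b := by positivity
    have hbY : b ≤ y * N + b := by have : 0 ≤ y * N := by positivity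
                                   linarith
    have hYX : (y * N + b) - (x * N + b) = N * (y - x) := by ring
    set X := x * N + b
    set Y := y * N + b
    have hl : Real.log X - Real.log Y ≤ X / Y - 1 := by
      rw [← Real.log_div hX.ne' hY.ne']
      exact Real.log_le_sub_one_of_pos (by positivity)
    have h1 : (Y - X) + X * (Real.log X - Real.log Y) ≤ (Y - X) ^ 2 / b := by
      calc _ ≤ (Y - X) + X * (X / Y - 1) := by gcongr
        _ = (Y - X) ^ 2 / Y := by field_simp; ring
        _ ≤ _ := by gcongr
    have h2 : (y - x) = (Y - X) / N := by rw [hYX]; field_simp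
    have h3 : (y - x) * (Real.log Y + 1) + Real.negMulLog Y / N - Real.negMulLog X / N =
       ((Y - X) + X * (Real.log X - Real.log Y)) / N := by
      rw [h2, Real.negMulLog, Real.negMulLog]; ring
    have h4 : N / b * (y - x) ^ 2 = ((Y - X) ^ 2 / b) / N := by rw [hYX]; field_simp
    have h5 := div_le_div_of_nonneg_right h1 hN.le
    rw [← h3, ← h4] at h5
    linarith

lemma core' [Nonempty n] [Nonempty m] {ψ : Matrix (n × m) (n × m) ℂ} (h : ψ.PosSemidef) (ht : rtr ψ = 1) {a b N : ℝ}
    (hNd : N = Fintype.card m) (hb : 0 ≤ b) (ha : 0 ≤ a) :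
    N * Real.negMulLog b + (N * b + a) * rtr (cfc Real.negMulLog (ptR ψ))
      + (Real.negMulLog (a * N + b) - Real.negMulLog b) / N ≤
      rtr (cfc Real.negMulLog (om ψ a b)) := by
  set c : ℝ := (Fintype.card (n × m) : ℝ)⁻¹ with hc
  have hcard : (0 : ℝ) < Fintype.card (n × m) := by exact_mod_cast Fintype.card_pos
  have hc0 : 0 < c := inv_pos.2 hcard
  let P : ℝ → Matrix (n × m) (n × m) ℂ := fun t => (1 - t) • ψ + (t * c) • (1 : Matrix (n × m) (n × m) ℂ)
  have hP : Continuous P := by fun_prop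
  have hPh : ∀ t, (P t).IsHermitian := fun t =>
    ((IsSelfAdjoint.all (1 - t)).smul (show IsSelfAdjoint ψ from h.isHermitian)).add
      ((IsSelfAdjoint.all (t * c)).smul (IsSelfAdjoint.one _))
  have hR : Continuous fun t => ptR (P t) := by
    unfold ptR
    refine continuous_matrix fun i j => ?_
    simp only [Matrix.of_apply]
    refine continuous_finsetSum _ fun k _ => ?_
    exact hP.matrix_elem _ _
  have hRh := fun t => ptR_herm (hPh t)
  have hkr : Continuous (kr m : Matrix n n ℂ → Matrix (n × m) (n × m) ℂ) :=
    LinearMap.continuous_of_finiteDimensional ((kr m).toAlgHom.toLinearMap : Matrix n n ℂ →ₗ[ℝ] Matrix (n × m) (n × m) ℂ)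
  have hO : Continuous fun t => om (P t) a (b + t) := by
    unfold om
    have := hkr.comp hR
    simp only [Function.comp_def] at this
    fun_prop
  have hOh : ∀ t, (om (P t) a (b + t)).IsHermitian := fun t =>
    ((IsSelfAdjoint.all a).smul (show IsSelfAdjoint (P t) from hPh t)).add
      ((IsSelfAdjoint.all (b + t)).smul ((show IsSelfAdjoint (ptR (P t)) from hRh t).map (kr m)))
  have c1 := continuous_ent _ hR hRh
  have c2 := continuous_ent _ hO hOh
  have c3 : Continuous fun t => N * Real.negMulLog (b + t) + (N * (b + t) + a) * rtr (cfc Real.negMulLog (ptR (P t)))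
      + (Real.negMulLog (a * N + (b + t)) - Real.negMulLog (b + t)) / N := by
    have := Real.continuous_negMulLog
    fun_prop
  have P0 : P 0 = ψ := by simp [P]
  have l3 := (c3.tendsto 0).mono_left (nhdsWithin_le_nhds (s := Set.Ioi 0))
  have l2 := (c2.tendsto 0).mono_left (nhdsWithin_le_nhds (s := Set.Ioi 0))
  simp only [P0, add_zero] at l3 l2
  refine le_of_tendsto_of_tendsto l3 l2 ?_
  have ev : ∀ᶠ t : ℝ in nhdsWithin 0 (Set.Ioi 0), t ∈ Set.Ioo (0 : ℝ) 1 :=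
    Ioo_mem_nhdsGT one_pos
  filter_upwards [ev] with t htt
  refine core ?_ ?_ hNd (by linarith [htt.1]) ha
  · exact Matrix.PosDef.posSemidef_add (h.smul (by linarith [htt.2])) (Matrix.PosDef.one.smul (mul_pos htt.1 hc0))
  · simp only [P]
    rw [rtr_add, rtr_smul, rtr_smul, ht]
    have : rtr (1 : Matrix (n × m) (n × m) ℂ) = Fintype.card (n × m) := by simp [rtr, Matrix.trace_one]
    rw [this, hc]
    field_simp
    ring

lemma ext_dep (d : ℕ) (p : ℝ) (ψ : Matrix (Fin d × Fin d) (Fin d × Fin d) ℂ) :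
    ext (depolarizingCh d p) ψ = om ψ (1 - p) (p / d) := by
  ext ⟨i, k⟩ ⟨j, l⟩
  simp only [ext, depolarizingCh, om, Matrix.of_apply, Matrix.add_apply, Matrix.smul_apply, kr_apply, ptR,
    Matrix.trace, Matrix.diag, Matrix.one_apply]
  by_cases h : k = l
  · simp [h]; ring
  · simp [h]

lemma ptR_om (d : ℕ) (hd : 0 < d) (p : ℝ) (ψ : Matrix (Fin d × Fin d) (Fin d × Fin d) ℂ) :
    ptR (om ψ (1 - p) (p / d)) = ptR ψ := by
  ext i j
  have : (d : ℂ) ≠ 0 := by exact_mod_cast hd.ne'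
  simp only [om, ptR, Matrix.of_apply, Matrix.add_apply, Matrix.smul_apply, kr_apply, Finset.sum_add_distrib, if_true]
  simp [← Finset.mul_sum]
  field_simp
  ring

lemma om_herm {ψ : Matrix (n × m) (n × m) ℂ} (h : ψ.IsHermitian) (a b : ℝ) : (om ψ a b).IsHermitian :=
  ((IsSelfAdjoint.all a).smul (show IsSelfAdjoint ψ from h)).add
      ((IsSelfAdjoint.all b).smul ((show IsSelfAdjoint (ptR ψ) from ptR_herm h).map (kr m)))

lemma condEnt_eq (d : ℕ) (hd : 0 < d) (p : ℝ) (ψ : Matrix (Fin d × Fin d) (Fin d × Fin d) ℂ) (h : ψ.IsHermitian) :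
    condEntB (ext (depolarizingCh d p) ψ) =
      (rtr (cfc Real.negMulLog (om ψ (1 - p) (p / d))) - rtr (cfc Real.negMulLog (ptR ψ))) / Real.log 2 := by
  rw [condEntB, ext_dep, ptR_om d hd, vnEntropy_eq (om_herm h _ _), vnEntropy_eq (ptR_herm h), sub_div]

/-- the maximally entangled state -/
noncomputable def mes (d : ℕ) : Matrix (Fin d × Fin d) (Fin d × Fin d) ℂ :=
  Matrix.of fun x y => if x.1 = x.2 then (if y.1 = y.2 then (d : ℂ)⁻¹ else 0) else 0

lemma mes_herm (d : ℕ) : (mes d).IsHermitian := by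
  ext ⟨i, k⟩ ⟨j, l⟩
  simp only [mes, Matrix.conjTranspose_apply, Matrix.of_apply]
  by_cases h : i = k <;> by_cases h' : j = l <;> simp [h, h']

lemma mes_idem (d : ℕ) (hd : 0 < d) : mes d * mes d = mes d := by
  have : (d : ℂ) ≠ 0 := by exact_mod_cast hd.ne'
  ext ⟨i, k⟩ ⟨j, l⟩
  simp only [mes, Matrix.mul_apply, Matrix.of_apply, Fintype.sum_prod_type]
  by_cases h : i = k <;> by_cases h' : j = l <;> simp [h, h', this]

lemma mes_trace (d : ℕ) (hd : 0 < d) : (mes d).trace = 1 := by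
  have : (d : ℂ) ≠ 0 := by exact_mod_cast hd.ne'
  simp only [mes, Matrix.trace, Matrix.diag, Matrix.of_apply, Fintype.sum_prod_type]
  simp [this]

lemma mes_pure (d : ℕ) (hd : 0 < d) : IsPure (mes d) := by
  refine ⟨⟨?_, mes_trace d hd⟩, mes_idem d hd⟩
  have := Matrix.posSemidef_conjTranspose_mul_self (mes d)
  rwa [(mes_herm d).eq, mes_idem d hd] at this

lemma mes_ptR (d : ℕ) : ptR (mes d) = algebraMap ℝ (Matrix (Fin d) (Fin d) ℂ) ((d : ℝ)⁻¹) := by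
  ext i j
  simp only [ptR, mes, Matrix.of_apply, Matrix.algebraMap_matrix_apply]
  by_cases h : i = j
  · simp [h]
  · simp [h, Ne.symm h]

lemma cfc_proj {A : Matrix n n ℂ} (h : A.IsHermitian) (hi : A * A = A) (f : ℝ → ℝ) (a c : ℝ) :
    cfc f (a • A + algebraMap ℝ _ c) = (f (a + c) - f c) • A + algebraMap ℝ _ (f c) := by
  have sA : IsSelfAdjoint A := h
  have hco : ∀ g : ℝ → ℝ, ContinuousOn g (spectrum ℝ A) := fun g => Matrix.finite_real_spectrum.continuousOn _
  have gen : ∀ u v : ℝ, cfc (fun x => u * id x + v) A = u • A + algebraMap ℝ _ v := by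
    intro u v
    rw [cfc_add _ _ _ (hco _) (hco _), cfc_const_mul _ _ _ (hco _), cfc_id ℝ A, cfc_const v A]
  have hspec : ∀ x ∈ spectrum ℝ A, x = 0 ∨ x = 1 := by
    intro x hx
    have h1 : cfc (fun x : ℝ => id x * id x - id x) A = 0 := by
      rw [cfc_sub _ _ _ (hco _) (hco _), cfc_mul _ _ _ (hco _) (hco _), cfc_id ℝ A, hi, sub_self]
    have h2 : spectrum ℝ (cfc (fun x : ℝ => id x * id x - id x) A) = _ := cfc_map_spectrum _ _ sA (hco _)
    have h3 : x * x - x ∈ spectrum ℝ (cfc (fun x : ℝ => id x * id x - id x) A) := by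
      rw [h2]; exact ⟨x, hx, rfl⟩
    rw [h1] at h3
    have h4 : x * x - x = 0 := by
      by_contra hne
      exact h3 (by
        rw [spectrum.mem_resolventSet_iff, sub_zero]
        exact (IsUnit.mk0 _ hne).map (algebraMap ℝ (Matrix n n ℂ)))
    have : x * (x - 1) = 0 := by linarith
    rcases mul_eq_zero.1 this with h | h
    · exact Or.inl h
    · exact Or.inr (by linarith)
  rw [← gen, ← gen, ← cfc_comp f _ A sA (((Matrix.finite_real_spectrum (A := A)).image _).continuousOn _) (hco _)]
  refine cfc_congr fun x hx => ?_
  rcases hspec x hx with rfl | rfl <;> simp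

end Aux

/-- H(Δ^p) = −(1−p+p/d²)log₂(1−p+p/d²) − (d²−1)(p/d²)log₂(p/d²) − log₂ d. -/
theorem chEnt_depolarizing (d : ℕ) (hd : 0 < d) (p : ℝ) (hp0 : 0 ≤ p) (hp1 : p ≤ 1) :
    chEnt (depolarizingCh d p) =
      -((1 - p + p / d ^ 2) * Real.logb 2 (1 - p + p / d ^ 2)) -
        ((d : ℝ) ^ 2 - 1) * (p / d ^ 2) * Real.logb 2 (p / d ^ 2) -
          Real.logb 2 d := by
  have hl2 : 0 < Real.log 2 := Real.log_pos one_lt_two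
  have hdR : (0 : ℝ) < d := by exact_mod_cast hd
  haveI : Nonempty (Fin d) := ⟨⟨0, hd⟩⟩
  have hrhs : -((1 - p + p / d ^ 2) * Real.logb 2 (1 - p + p / d ^ 2)) -
        ((d : ℝ) ^ 2 - 1) * (p / d ^ 2) * Real.logb 2 (p / d ^ 2) - Real.logb 2 d =
      (Real.negMulLog (1 - p + p / d ^ 2) + ((d : ℝ) ^ 2 - 1) * Real.negMulLog (p / d ^ 2) - Real.log d)
        / Real.log 2 := by
    simp only [Real.logb, Real.negMulLog]; ring
  rw [hrhs, chEnt]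
  refine IsLeast.csInf_eq ⟨⟨mes d, mes_pure d hd, ?_⟩, ?_⟩
  · rw [condEnt_eq d hd p _ (mes_herm d)]
    congr 1
    have e1 : om (mes d) (1 - p) (p / d) = (1 - p) • mes d + algebraMap ℝ _ (p / d ^ 2) := by
      rw [om, mes_ptR, AlgHomClass.commutes, Algebra.algebraMap_eq_smul_one, Algebra.algebraMap_eq_smul_one, smul_smul]
      congr 2
      field_simp
    have t1 : rtr (mes d) = 1 := by rw [rtr, mes_trace d hd]; simp
    have t2 : ∀ (k : Type) [Fintype k] [DecidableEq k] (r : ℝ),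
        rtr (algebraMap ℝ (Matrix k k ℂ) r) = r * Fintype.card k := by
      intro k _ _ r
      rw [Algebra.algebraMap_eq_smul_one, rtr_smul]
      simp [rtr, Matrix.trace_one]
    rw [e1, cfc_proj (mes_herm d) (mes_idem d hd), mes_ptR, cfc_algebraMap, rtr_add, rtr_smul, t1, t2, t2]
    have : Real.negMulLog ((d : ℝ)⁻¹) * d = Real.log d := by
      rw [Real.negMulLog, Real.log_inv]; field_simp
    simp only [Fintype.card_prod, Fintype.card_fin, this]
    push_cast
    ring
  · rintro x ⟨ψ, hψ, rfl⟩
    rw [condEnt_eq d hd p _ hψ.1.1.isHermitian]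
    refine div_le_div_of_nonneg_right ?_ hl2.le
    have t1 : rtr ψ = 1 := by rw [rtr, hψ.1.2]; simp
    have hc := core' hψ.1.1 t1 (a := 1 - p) (b := p / d) (N := d) (by simp) (by positivity) (by linarith)
    have e1 : (d : ℝ) * (p / d) + (1 - p) = 1 := by field_simp; ring
    have e2 : (1 - p) * d + p / d = d * (1 - p + p / d ^ 2) := by field_simp
    have e3 : p / d = d * (p / d ^ 2) := by field_simp
    rw [e1, e2] at hc
    have e4 : (d : ℝ) * Real.negMulLog (p / d) + (Real.negMulLog (d * (1 - p + p / d ^ 2)) - Real.negMulLog (p / d)) / d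
        = Real.negMulLog (1 - p + p / d ^ 2) + ((d : ℝ) ^ 2 - 1) * Real.negMulLog (p / d ^ 2) - Real.log d := by
      rw [e3, Real.negMulLog_mul, Real.negMulLog_mul]
      have : Real.negMulLog (d : ℝ) = - d * Real.log d := rfl
      rw [this]
      field_simp
      ring
    linarith

end QCh
end

section
/- If a channel N_{A→B} is covariant with respect to a group G (N ∘ U^g = V^g ∘ N for unitary representations), then the optimization in −H(N) = sup_{ρ_A} H(B|E)_{U(ρ)} can be restricted to group-symmetrized input states: H(N) = −sup over ρ_A with ρ_A = (1/|G|)Σ_g U^g(ρ_A) of H(B|E)_{U(ρ)}. In particular, if (1/|G|)Σ_g U^g is the completely depolarizing map, the maximally mixed input is optimal. -/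
open Matrix BigOperators
open scoped Kronecker ComplexOrder

namespace QCh

variable {n m : Type*} [Fintype n] [DecidableEq n] [Fintype m] [DecidableEq m]

open Filter Topology in
theorem log_sum_tend {ι : Type*} [Fintype ι] (a x : ι → ℝ)  (hs : ∑ i, a i = 1) :
    Tendsto (fun T => ∑ i, a i * Real.log (x i + T) - Real.log T) atTop (𝓝 0) := by
  have h1 : Tendsto (fun T => ∑ i, a i * Real.log (x i / T + 1)) atTop (𝓝 (∑ i, a i * Real.log (0 + 1))) := by
    refine tendsto_finsetSum _ fun i _ => Tendsto.const_mul _ ?_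
    refine (Real.continuousAt_log (by norm_num)).tendsto.comp ?_
    exact (tendsto_const_nhds.div_atTop tendsto_id).add tendsto_const_nhds
  simp only [zero_add, Real.log_one, mul_zero, Finset.sum_const_zero] at h1
  have h3 : ∀ᶠ T : ℝ in atTop, ∀ i, 0 < x i + T := by
    rw [Filter.eventually_all]
    intro i
    filter_upwards [eventually_gt_atTop (-x i)] with T hT
    linarith
  refine h1.congr' ?_
  filter_upwards [eventually_gt_atTop 0, h3] with T hT h4
  have : Real.log T = ∑ i, a i * Real.log T := by rw [← Finset.sum_mul, hs, one_mul]
  rw [this, ← Finset.sum_sub_distrib]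
  refine Finset.sum_congr rfl fun i _ => ?_
  rw [← mul_sub, ← Real.log_div (h4 i).ne' hT.ne', add_div, div_self hT.ne']

open Filter Topology in
theorem scalar_cmp {ι κ : Type*} [Fintype ι] [Fintype κ] (a x : ι → ℝ) (b y : κ → ℝ)
    (hx : ∀ i, 0 ≤ x i) (hy : ∀ i, 0 ≤ y i)
    (ha1 : ∑ i, a i = 1) (hb1 : ∑ i, b i = 1)
    (hax : ∀ i, a i ≠ 0 → x i ≠ 0) (hby : ∀ i, b i ≠ 0 → y i ≠ 0)
    (h : ∀ T : ℝ, 0 < T → ∑ i, b i / (y i + T) ≤ ∑ i, a i / (x i + T)) :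
    ∑ i, a i * Real.log (x i) ≤ ∑ i, b i * Real.log (y i) := by
  set D : ℝ → ℝ := fun T => ∑ i, a i * Real.log (x i + T) - ∑ i, b i * Real.log (y i + T) with hD
  have hder : ∀ T : ℝ, 0 < T → HasDerivAt D (∑ i, a i / (x i + T) - ∑ i, b i / (y i + T)) T := by
    intro T hT
    refine HasDerivAt.sub ?_ ?_
    · refine HasDerivAt.fun_sum fun i _ => ?_
      have := (((hasDerivAt_id T).const_add (x i)).log (by have := hx i; simp only [id]; positivity)).const_mul (a i)
      simpa [div_eq_mul_inv] using this
    · refine HasDerivAt.fun_sum fun i _ => ?_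
      have := (((hasDerivAt_id T).const_add (y i)).log (by have := hy i; simp only [id]; positivity)).const_mul (b i)
      simpa [div_eq_mul_inv] using this
  have hmono : MonotoneOn D (Set.Ioi 0) := by
    refine monotoneOn_of_deriv_nonneg (convex_Ioi 0) ?_ ?_ ?_
    · exact fun T hT => (hder T hT).continuousAt.continuousWithinAt
    · rw [interior_Ioi]
      exact fun T hT => (hder T hT).differentiableAt.differentiableWithinAt
    · rw [interior_Ioi]
      intro T hT
      rw [(hder T hT).deriv]
      exact sub_nonneg.2 (h T hT)
  have hlim : Tendsto D atTop (𝓝 0) := by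
    have := (log_sum_tend a x ha1).sub (log_sum_tend b y hb1)
    simpa [hD] using this
  have hneg : ∀ T, 0 < T → D T ≤ 0 := by
    intro T hT
    refine ge_of_tendsto hlim ?_
    filter_upwards [eventually_ge_atTop T] with S hS
    exact hmono hT (lt_of_lt_of_le hT hS) hS
  have hc : ∀ {ι : Type _} [Fintype ι] (a x : ι → ℝ), (∀ i, a i ≠ 0 → x i ≠ 0) →
      Tendsto (fun T => ∑ i, a i * Real.log (x i + T)) (𝓝[>] 0) (𝓝 (∑ i, a i * Real.log (x i))) := by
    intro ι _ a x hax
    refine tendsto_finsetSum _ fun i _ => ?_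
    by_cases hi : a i = 0
    · simp [hi]
    · refine Tendsto.const_mul _ ?_
      refine (Real.continuousAt_log (hax i hi)).tendsto.comp ?_
      have : Tendsto (fun T : ℝ => x i + T) (𝓝 0) (𝓝 (x i + 0)) := tendsto_const_nhds.add tendsto_id
      rw [add_zero] at this
      exact this.mono_left nhdsWithin_le_nhds
  have hc2 : ∀ {ι : Type _} [Fintype ι] (a x : ι → ℝ), (∀ i, a i ≠ 0 → x i ≠ 0) →
      Tendsto (fun T => ∑ i, a i * Real.log (x i + T)) (𝓝[>] 0) (𝓝 (∑ i, a i * Real.log (x i))) := by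
    intro ι _ a x hax
    refine tendsto_finsetSum _ fun i _ => ?_
    by_cases hi : a i = 0
    · simp [hi]
    · refine Tendsto.const_mul _ ?_
      refine (Real.continuousAt_log (hax i hi)).tendsto.comp ?_
      have : Tendsto (fun T : ℝ => x i + T) (𝓝 0) (𝓝 (x i + 0)) := tendsto_const_nhds.add tendsto_id
      rw [add_zero] at this
      exact this.mono_left nhdsWithin_le_nhds
  have := le_of_tendsto ((hc a x hax).sub (hc2 b y hby)) (b := 0) (by
    filter_upwards [self_mem_nhdsWithin] with T hT
    exact hneg T hT)
  linarith

/-- The quadratic functional of the variational formula. -/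
noncomputable def Jfun (T : ℝ) (ρ σ K : Matrix n n ℂ) : ℝ :=
  2 * (ρ * K).trace.re - (σ * (Kᴴ * K)).trace.re - T * (ρ * (K * Kᴴ)).trace.re

theorem scalar_quad (p q T : ℝ) (hp : 0 ≤ p) (hq : 0 ≤ q) (hT : 0 < T) (z c : ℂ) :
    2 * (p * (z * star c).re) - q * ‖z‖ ^ 2 - T * (p * ‖z‖ ^ 2) ≤ ‖c‖ ^ 2 * (p ^ 2 / (q + T * p)) := by
  have hz : ‖z‖ ^ 2 = z.re ^ 2 + z.im ^ 2 := by rw [Complex.sq_norm, Complex.normSq_apply]; ring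
  have hc : ‖c‖ ^ 2 = c.re ^ 2 + c.im ^ 2 := by rw [Complex.sq_norm, Complex.normSq_apply]; ring
  have hr : (z * star c).re = z.re * c.re + z.im * c.im := by simp
  rw [hz, hc, hr]
  have hd : 0 ≤ q + T * p := by positivity
  rcases hd.eq_or_lt with h0 | hpos
  · have h1 : T * p = 0 := by nlinarith [mul_nonneg hT.le hp]
    have hp0 : p = 0 := by
      rcases mul_eq_zero.1 h1 with h | h
      · exact absurd h hT.ne'
      · exact h
    have hq0 : q = 0 := by linarith
    simp [hp0, hq0]
  · rw [← mul_div_assoc, le_div_iff₀ hpos]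
    nlinarith [sq_nonneg ((q + T * p) * z.re - p * c.re), sq_nonneg ((q + T * p) * z.im - p * c.im)]

theorem scalar_quad_eq (p q T : ℝ) (hp : 0 ≤ p) (hq : 0 ≤ q) (hT : 0 < T) (c : ℂ) :
    2 * (p * ((((p / (q + T * p) : ℝ) : ℂ) * c) * star c).re) - q * ‖((p / (q + T * p) : ℝ) : ℂ) * c‖ ^ 2
      - T * (p * ‖((p / (q + T * p) : ℝ) : ℂ) * c‖ ^ 2) = ‖c‖ ^ 2 * (p ^ 2 / (q + T * p)) := by
  have hd : 0 ≤ q + T * p := by positivity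
  have h1 : ((((p / (q + T * p) : ℝ) : ℂ) * c) * star c).re = p / (q + T * p) * ‖c‖ ^ 2 := by
    rw [mul_assoc, Complex.star_def, Complex.mul_conj, Complex.re_ofReal_mul, Complex.ofReal_re,
      Complex.normSq_eq_norm_sq]
  rw [h1, norm_mul, mul_pow, Complex.norm_real, Real.norm_eq_abs, sq_abs]
  rcases hd.eq_or_lt with h0 | hpos
  · rw [← h0]; simp
  · obtain ⟨d, hd'⟩ : ∃ d, d = q + T * p := ⟨_, rfl⟩
    have hq' : q = d - T * p := by linarith
    rw [← hd'] at hpos ⊢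
    rw [hq']
    field_simp
    ring

theorem trace_form (p : n → ℝ) (L C : Matrix n n ℂ) :
    (diagonal (fun i => (p i : ℂ)) * (L * Cᴴ)).trace.re = ∑ i, ∑ j, p i * (L i j * star (C i j)).re := by
  simp only [trace, diag_apply, diagonal_mul, Complex.re_sum, Complex.re_ofReal_mul]
  refine Finset.sum_congr rfl fun i _ => ?_
  rw [mul_apply, Complex.re_sum, Finset.mul_sum]
  rfl

theorem mul_star_re (z : ℂ) : (z * star z).re = ‖z‖ ^ 2 := by
  rw [Complex.star_def, Complex.mul_conj, Complex.ofReal_re, Complex.normSq_eq_norm_sq]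

theorem Jfun_eq (T : ℝ) (P Q : Matrix n n ℂ) (hP : Pᴴ * P = 1) (hQ : Qᴴ * Q = 1)
    (p q : n → ℝ) (L : Matrix n n ℂ) :
    Jfun T (P * diagonal (fun i => (p i : ℂ)) * Pᴴ) (Q * diagonal (fun i => (q i : ℂ)) * Qᴴ) (P * L * Qᴴ)
      = ∑ i, ∑ j, (2 * (p i * (L i j * star ((Pᴴ * Q) i j)).re) - q j * ‖L i j‖ ^ 2
          - T * (p i * ‖L i j‖ ^ 2)) := by
  have h1 : (P * diagonal (fun i => (p i : ℂ)) * Pᴴ * (P * L * Qᴴ)).trace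
      = (diagonal (fun i => (p i : ℂ)) * (L * (Pᴴ * Q)ᴴ)).trace := by
    rw [show P * diagonal (fun i => (p i : ℂ)) * Pᴴ * (P * L * Qᴴ)
      = P * (diagonal (fun i => (p i : ℂ)) * (Pᴴ * P) * L * Qᴴ) by simp only [Matrix.mul_assoc],
      hP, trace_mul_comm, conjTranspose_mul, conjTranspose_conjTranspose]
    simp only [Matrix.mul_assoc, Matrix.mul_one]
  have h2 : (Q * diagonal (fun i => (q i : ℂ)) * Qᴴ * ((P * L * Qᴴ)ᴴ * (P * L * Qᴴ))).trace
      = (diagonal (fun i => (q i : ℂ)) * (Lᴴ * Lᴴᴴ)).trace := by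
    rw [show Q * diagonal (fun i => (q i : ℂ)) * Qᴴ * ((P * L * Qᴴ)ᴴ * (P * L * Qᴴ))
      = Q * (diagonal (fun i => (q i : ℂ)) * (Qᴴ * Q) * Lᴴ * (Pᴴ * P) * L * Qᴴ) by
        simp only [Matrix.mul_assoc, conjTranspose_mul, conjTranspose_conjTranspose],
      hP, hQ, trace_mul_comm, conjTranspose_conjTranspose]
    simp only [Matrix.mul_assoc, Matrix.mul_one, hQ]
  have h3 : (P * diagonal (fun i => (p i : ℂ)) * Pᴴ * ((P * L * Qᴴ) * (P * L * Qᴴ)ᴴ)).trace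
      = (diagonal (fun i => (p i : ℂ)) * (L * Lᴴ)).trace := by
    rw [show P * diagonal (fun i => (p i : ℂ)) * Pᴴ * ((P * L * Qᴴ) * (P * L * Qᴴ)ᴴ)
      = P * (diagonal (fun i => (p i : ℂ)) * (Pᴴ * P) * L * (Qᴴ * Q) * Lᴴ * Pᴴ) by
        simp only [Matrix.mul_assoc, conjTranspose_mul, conjTranspose_conjTranspose],
      hP, hQ, trace_mul_comm]
    simp only [Matrix.mul_assoc, Matrix.mul_one]
    rw [hP, Matrix.mul_one]
  unfold Jfun
  rw [h1, h2, h3, trace_form, trace_form, trace_form]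
  rw [Finset.sum_comm (f := fun i j => q i * _)]
  simp only [conjTranspose_apply, mul_star_re, norm_star, Finset.mul_sum, ← Finset.sum_sub_distrib]

/-- Variational bound. -/
theorem Jfun_le (T : ℝ) (hT : 0 < T) (P Q : Matrix n n ℂ) (hP : Pᴴ * P = 1) (hQ : Qᴴ * Q = 1)
    (p q : n → ℝ) (hp : ∀ i, 0 ≤ p i) (hq : ∀ i, 0 ≤ q i) (K : Matrix n n ℂ) :
    Jfun T (P * diagonal (fun i => (p i : ℂ)) * Pᴴ) (Q * diagonal (fun i => (q i : ℂ)) * Qᴴ) K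
      ≤ ∑ i, ∑ j, ‖(Pᴴ * Q) i j‖ ^ 2 * (p i ^ 2 / (q j + T * p i)) := by
  have hK : K = P * (Pᴴ * K * Q) * Qᴴ := by
    rw [show P * (Pᴴ * K * Q) * Qᴴ = (P * Pᴴ) * K * (Q * Qᴴ) by simp only [Matrix.mul_assoc],
      mul_eq_one_comm.1 hP, mul_eq_one_comm.1 hQ, Matrix.one_mul, Matrix.mul_one]
  rw [hK, Jfun_eq T P Q hP hQ]
  exact Finset.sum_le_sum fun i _ => Finset.sum_le_sum fun j _ =>
    scalar_quad _ _ _ (hp i) (hq j) hT _ _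

theorem exists_Jfun_eq (T : ℝ) (hT : 0 < T) (P Q : Matrix n n ℂ) (hP : Pᴴ * P = 1) (hQ : Qᴴ * Q = 1)
    (p q : n → ℝ) (hp : ∀ i, 0 ≤ p i) (hq : ∀ i, 0 ≤ q i) :
    ∃ K, Jfun T (P * diagonal (fun i => (p i : ℂ)) * Pᴴ) (Q * diagonal (fun i => (q i : ℂ)) * Qᴴ) K
      = ∑ i, ∑ j, ‖(Pᴴ * Q) i j‖ ^ 2 * (p i ^ 2 / (q j + T * p i)) := by
  refine ⟨P * (Matrix.of fun i j => ((p i / (q j + T * p i) : ℝ) : ℂ) * (Pᴴ * Q) i j) * Qᴴ, ?_⟩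
  rw [Jfun_eq T P Q hP hQ]
  exact Finset.sum_congr rfl fun i _ => Finset.sum_congr rfl fun j _ =>
    scalar_quad_eq _ _ _ (hp i) (hq j) hT _

theorem trace_ptL_mul {B E : Type*} [Fintype B] [DecidableEq B] [Fintype E] [DecidableEq E]
    (M : Matrix (B × E) (B × E) ℂ) (K : Matrix E E ℂ) :
    (ptL M * K).trace = (M * ((1 : Matrix B B ℂ) ⊗ₖ K)).trace := by
  simp only [trace, diag_apply, mul_apply, ptL, of_apply, Fintype.sum_prod_type, kronecker_apply,
    one_apply, Finset.sum_mul, ite_mul, one_mul, zero_mul, mul_ite, mul_zero]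
  have : ∀ x y, (∑ x_1, ∑ x_2, if x_1 = x then M (x, y) (x_1, x_2) * K x_2 y else 0)
      = ∑ x_2, M (x, y) (x, x_2) * K x_2 y := by
    intro x y
    rw [Finset.sum_comm]
    simp
  simp only [this]
  rw [Finset.sum_comm]
  conv_rhs => rw [Finset.sum_comm]
  rw [Finset.sum_comm]
  exact Finset.sum_congr rfl fun i _ => Finset.sum_comm

theorem Jfun_ptL {B E : Type*} [Fintype B] [DecidableEq B] [Fintype E] [DecidableEq E] (T : ℝ)
    (ρ σ : Matrix (B × E) (B × E) ℂ) (K : Matrix E E ℂ) :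
    Jfun T (ptL ρ) (ptL σ) K = Jfun T ρ σ ((1 : Matrix B B ℂ) ⊗ₖ K) := by
  unfold Jfun
  rw [trace_ptL_mul, trace_ptL_mul, trace_ptL_mul, conjTranspose_kronecker, ← mul_kronecker_mul,
    ← mul_kronecker_mul, conjTranspose_one, Matrix.one_mul]

theorem spec_unitary {A : Matrix n n ℂ} (h : A.IsHermitian) :
    (h.eigenvectorUnitary : Matrix n n ℂ)ᴴ * (h.eigenvectorUnitary : Matrix n n ℂ) = 1 :=
  (Matrix.mem_unitaryGroup_iff').1 h.eigenvectorUnitary.2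

theorem spec_eq {A : Matrix n n ℂ} (h : A.IsHermitian) :
    A = (h.eigenvectorUnitary : Matrix n n ℂ) * diagonal (fun i => (h.eigenvalues i : ℂ)) *
      (h.eigenvectorUnitary : Matrix n n ℂ)ᴴ := by
  conv_lhs => rw [h.spectral_theorem, Unitary.conjStarAlgAut_apply]
  rfl

/-- The cross term `tr ρ log σ`. -/
noncomputable def Xent (ρ σ : Matrix n n ℂ) : ℝ :=
  if h : σ.IsHermitian then
    ∑ j, (((h.eigenvectorUnitary : Matrix n n ℂ)ᴴ * ρ * (h.eigenvectorUnitary : Matrix n n ℂ)) j j).re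
      * Real.logb 2 (h.eigenvalues j) else 0

theorem Xent_self {σ : Matrix n n ℂ} (h : σ.IsHermitian) : Xent σ σ = - vnEntropy σ := by
  unfold Xent vnEntropy
  rw [dif_pos h, dif_pos h, neg_neg]
  refine Finset.sum_congr rfl fun j _ => ?_
  have h1 : (h.eigenvectorUnitary : Matrix n n ℂ)ᴴ * σ * (h.eigenvectorUnitary : Matrix n n ℂ)
      = diagonal (fun i => (h.eigenvalues i : ℂ)) := by
    obtain ⟨U, hU⟩ : ∃ U : Matrix n n ℂ, U = h.eigenvectorUnitary := ⟨_, rfl⟩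
    have h2 := spec_eq h
    have h3 := spec_unitary h
    rw [← hU] at h2 h3 ⊢
    conv_lhs => rw [h2]
    rw [show Uᴴ * (U * diagonal (fun i => (h.eigenvalues i : ℂ)) * Uᴴ) * U
      = (Uᴴ * U) * diagonal (fun i => (h.eigenvalues i : ℂ)) * (Uᴴ * U) by
        simp only [Matrix.mul_assoc], h3, Matrix.one_mul, Matrix.mul_one]
  rw [h1]
  simp

theorem Xent_sum {G : Type*} [Fintype G] (r : ℝ) (f : G → Matrix n n ℂ) (σ : Matrix n n ℂ) :
    Xent ((r : ℂ) • ∑ g, f g) σ = r * ∑ g, Xent (f g) σ := by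
  unfold Xent
  split_ifs with h
  · rw [Finset.sum_comm, Finset.mul_sum]
    refine Finset.sum_congr rfl fun j _ => ?_
    rw [← Finset.sum_mul, ← mul_assoc]
    congr 1
    rw [Matrix.mul_smul, Matrix.smul_mul, Matrix.smul_apply, smul_eq_mul, Complex.re_ofReal_mul,
      Matrix.mul_sum, Matrix.sum_mul, Matrix.sum_apply, Complex.re_sum]
  · simp

theorem diag_conj_re (P Q : Matrix n n ℂ) (p : n → ℝ) (j : n) :
    ((Qᴴ * (P * diagonal (fun i => (p i : ℂ)) * Pᴴ) * Q) j j).re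
      = ∑ i, ‖(Pᴴ * Q) i j‖ ^ 2 * p i := by
  have : Qᴴ * (P * diagonal (fun i => (p i : ℂ)) * Pᴴ) * Q
      = (Pᴴ * Q)ᴴ * diagonal (fun i => (p i : ℂ)) * (Pᴴ * Q) := by
    simp only [Matrix.mul_assoc, conjTranspose_mul, conjTranspose_conjTranspose]
  rw [this, mul_apply, Complex.re_sum]
  refine Finset.sum_congr rfl fun i _ => ?_
  rw [mul_diagonal, conjTranspose_apply, mul_right_comm, mul_comm (star _), ← mul_star_re,
    Complex.re_mul_ofReal]

theorem row_sum (P Q : Matrix n n ℂ) (hP : Pᴴ * P = 1) (hQ : Qᴴ * Q = 1) (i : n) :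
    ∑ j, ‖(Pᴴ * Q) i j‖ ^ 2 = 1 := by
  have h1 : (Pᴴ * Q) * (Pᴴ * Q)ᴴ = 1 := by
    rw [conjTranspose_mul, conjTranspose_conjTranspose,
      show Pᴴ * Q * (Qᴴ * P) = Pᴴ * (Q * Qᴴ) * P by simp only [Matrix.mul_assoc],
      mul_eq_one_comm.1 hQ, Matrix.mul_one, hP]
  have h2 := congrArg (fun M : Matrix n n ℂ => (M i i).re) h1
  simp only [mul_apply (M := Pᴴ * Q), Complex.re_sum, conjTranspose_apply (Pᴴ * Q), mul_star_re, one_apply_eq,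
    Complex.one_re] at h2
  exact h2

theorem weight_zero (P Q : Matrix n n ℂ) (hQ : Qᴴ * Q = 1)
    (p q : n → ℝ) (hp : ∀ i, 0 ≤ p i) (c : ℝ)
    (hle : ((c : ℂ) • (Q * diagonal (fun i => (q i : ℂ)) * Qᴴ)
      - P * diagonal (fun i => (p i : ℂ)) * Pᴴ).PosSemidef) (i j : n) (hj : q j = 0) :
    ‖(Pᴴ * Q) i j‖ ^ 2 * p i = 0 := by
  have h1 := (hle.conjTranspose_mul_mul_same Q).diag_nonneg (i := j)
  have h2 := (Complex.le_def.1 h1).1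
  rw [Matrix.mul_sub, Matrix.sub_mul, Matrix.sub_apply, Complex.sub_re, diag_conj_re,
    Matrix.mul_smul, Matrix.smul_mul, Matrix.smul_apply,
    show Qᴴ * (Q * diagonal (fun i => (q i : ℂ)) * Qᴴ) * Q
      = (Qᴴ * Q) * diagonal (fun i => (q i : ℂ)) * (Qᴴ * Q) by
        simp only [Matrix.mul_assoc], hQ, Matrix.one_mul, Matrix.mul_one, diagonal_apply_eq, hj] at h2
  simp only [Complex.ofReal_zero, smul_zero, Complex.zero_re, zero_sub] at h2
  have h3 : ∀ i ∈ Finset.univ, 0 ≤ ‖(Pᴴ * Q) i j‖ ^ 2 * p i :=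
    fun i _ => mul_nonneg (sq_nonneg _) (hp i)
  exact (Finset.sum_eq_zero_iff_of_nonneg h3).1
    (le_antisymm (by linarith) (Finset.sum_nonneg h3)) i (Finset.mem_univ i)

/-- Spectral data of a pair of states `ρ ≤ c σ`. -/
theorem pair_data {ρ σ : Matrix n n ℂ} (hρ : ρ.PosSemidef) (hσ : σ.PosSemidef) (htr : ρ.trace = 1)
    (c : ℝ) (hle : ((c : ℂ) • σ - ρ).PosSemidef) :
    ∃ a x : n × n → ℝ, (∀ i, 0 ≤ x i) ∧ ∑ i, a i = 1 ∧ (∀ i, a i ≠ 0 → x i ≠ 0) ∧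
      (∀ T : ℝ, 0 < T → (∀ K, Jfun T ρ σ K ≤ ∑ i, a i / (x i + T)) ∧
        ∃ K, Jfun T ρ σ K = ∑ i, a i / (x i + T)) ∧
      vnEntropy ρ + Xent ρ σ = (∑ i, a i * Real.log (x i)) / Real.log 2 := by
  obtain ⟨P, hPdef⟩ : ∃ U : Matrix n n ℂ, U = hρ.1.eigenvectorUnitary := ⟨_, rfl⟩
  obtain ⟨Q, hQdef⟩ : ∃ U : Matrix n n ℂ, U = hσ.1.eigenvectorUnitary := ⟨_, rfl⟩
  obtain ⟨p, hpdef⟩ : ∃ p, p = hρ.1.eigenvalues := ⟨_, rfl⟩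
  obtain ⟨q, hqdef⟩ : ∃ p, p = hσ.1.eigenvalues := ⟨_, rfl⟩
  have hp : ∀ i, 0 ≤ p i := by rw [hpdef]; exact hρ.eigenvalues_nonneg
  have hq : ∀ i, 0 ≤ q i := by rw [hqdef]; exact hσ.eigenvalues_nonneg
  have hP : Pᴴ * P = 1 := by rw [hPdef]; exact spec_unitary hρ.1
  have hQ : Qᴴ * Q = 1 := by rw [hQdef]; exact spec_unitary hσ.1
  have hρe : ρ = P * diagonal (fun i => (p i : ℂ)) * Pᴴ := by
    rw [hPdef, hpdef]; exact spec_eq hρ.1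
  have hσe : σ = Q * diagonal (fun i => (q i : ℂ)) * Qᴴ := by
    rw [hQdef, hqdef]; exact spec_eq hσ.1
  have hrow := row_sum P Q hP hQ
  have hzero : ∀ i j, q j = 0 → ‖(Pᴴ * Q) i j‖ ^ 2 * p i = 0 := by
    rw [hρe, hσe] at hle
    exact weight_zero P Q hQ p q hp c hle
  have hxp : ∀ i j, ‖(Pᴴ * Q) i j‖ ^ 2 * p i ≠ 0 → p i ≠ 0 ∧ q j ≠ 0 := by
    intro i j h
    refine ⟨fun h0 => h (by simp [h0]), fun h0 => h (hzero i j h0)⟩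
  have hterm : ∀ T : ℝ, 0 < T → ∑ i : n × n, ‖(Pᴴ * Q) i.1 i.2‖ ^ 2 * p i.1 / (q i.2 / p i.1 + T)
      = ∑ i, ∑ j, ‖(Pᴴ * Q) i j‖ ^ 2 * (p i ^ 2 / (q j + T * p i)) := by
    intro T hT
    rw [Fintype.sum_prod_type]
    refine Finset.sum_congr rfl fun i _ => Finset.sum_congr rfl fun j _ => ?_
    simp only
    rcases (hp i).eq_or_lt with h0 | h0
    · simp [← h0]
    · have h1 : q j / p i + T = (q j + T * p i) / p i := by field_simp
      have h2 : 0 < q j + T * p i := by have := hq j; positivity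
      rw [h1]
      field_simp
  refine ⟨fun i => ‖(Pᴴ * Q) i.1 i.2‖ ^ 2 * p i.1, fun i => q i.2 / p i.1,
    fun i => div_nonneg (hq _) (hp _), ?_, ?_, ?_, ?_⟩
  · rw [Fintype.sum_prod_type]
    simp only [← Finset.sum_mul, hrow, one_mul]
    have h1 := hρ.1.trace_eq_sum_eigenvalues
    rw [htr, ← hpdef] at h1
    have h2 := congrArg Complex.re h1
    simpa using h2.symm
  · intro i hi
    obtain ⟨h1, h2⟩ := hxp _ _ hi
    exact div_ne_zero h2 h1
  · intro T hT
    simp only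
    rw [hterm T hT, hρe, hσe]
    exact ⟨fun K => Jfun_le T hT P Q hP hQ p q hp hq K, exists_Jfun_eq T hT P Q hP hQ p q hp hq⟩
  · have h1 : vnEntropy ρ = - ∑ i, ∑ j, ‖(Pᴴ * Q) i j‖ ^ 2 * p i * Real.logb 2 (p i) := by
      unfold vnEntropy
      rw [dif_pos hρ.1, ← hpdef]
      simp only [← Finset.sum_mul, hrow, one_mul]
    have h2 : Xent ρ σ = ∑ i, ∑ j, ‖(Pᴴ * Q) i j‖ ^ 2 * p i * Real.logb 2 (q j) := by
      unfold Xent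
      rw [dif_pos hσ.1, ← hqdef, ← hQdef, Finset.sum_comm]
      refine Finset.sum_congr rfl fun j _ => ?_
      rw [← Finset.sum_mul]
      congr 1
      rw [hρe]
      exact diag_conj_re P Q p j
    rw [h1, h2, neg_add_eq_sub, Fintype.sum_prod_type, ← Finset.sum_sub_distrib, Finset.sum_div]
    refine Finset.sum_congr rfl fun i _ => ?_
    rw [← Finset.sum_sub_distrib, Finset.sum_div]
    refine Finset.sum_congr rfl fun j _ => ?_
    simp only
    by_cases h0 : ‖(Pᴴ * Q) i j‖ ^ 2 * p i = 0
    · simp [h0]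
    · obtain ⟨h3, h4⟩ := hxp _ _ h0
      rw [Real.log_div h4 h3, Real.logb, Real.logb]
      ring

section
variable {B E : Type*} [Fintype B] [DecidableEq B] [Fintype E] [DecidableEq E]

theorem ptL_sub (M N : Matrix (B × E) (B × E) ℂ) : ptL (M - N) = ptL M - ptL N := by
  ext i j; simp [ptL]

theorem ptL_smul (c : ℂ) (M : Matrix (B × E) (B × E) ℂ) : ptL (c • M) = c • ptL M := by
  ext i j; simp [ptL, Finset.mul_sum]

theorem ptL_sum {G : Type*} [Fintype G] (f : G → Matrix (B × E) (B × E) ℂ) :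
    ptL (∑ g, f g) = ∑ g, ptL (f g) := by
  ext i j; simp only [ptL, of_apply, Matrix.sum_apply]; exact Finset.sum_comm

theorem ptL_trace (M : Matrix (B × E) (B × E) ℂ) : (ptL M).trace = M.trace := by
  have := trace_ptL_mul M 1
  simpa using this

theorem ptL_posSemidef {M : Matrix (B × E) (B × E) ℂ} (h : M.PosSemidef) : (ptL M).PosSemidef := by
  have : ptL M = ∑ b : B, M.submatrix (fun e => (b, e)) (fun e => (b, e)) := by
    ext i j; simp [ptL, Matrix.sum_apply]
  rw [this]
  exact Matrix.posSemidef_sum _ fun b _ => h.submatrix _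

/-- Data processing for the partial trace. -/
theorem dpi {ρ σ : Matrix (B × E) (B × E) ℂ} (hρ : ρ.PosSemidef) (hσ : σ.PosSemidef)
    (htr : ρ.trace = 1) (c : ℝ) (hle : ((c : ℂ) • σ - ρ).PosSemidef) :
    vnEntropy ρ + Xent ρ σ ≤ vnEntropy (ptL ρ) + Xent (ptL ρ) (ptL σ) := by
  obtain ⟨a, x, hx, ha1, hax, hJ, hE⟩ := pair_data hρ hσ htr c hle
  have hle' : ((c : ℂ) • ptL σ - ptL ρ).PosSemidef := by
    rw [← ptL_smul, ← ptL_sub]; exact ptL_posSemidef hle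
  obtain ⟨b, y, hy, hb1, hby, hJ', hE'⟩ := pair_data (ptL_posSemidef hρ) (ptL_posSemidef hσ)
    (by rw [ptL_trace, htr]) c hle'
  rw [hE, hE']
  refine div_le_div_of_nonneg_right ?_ (Real.log_nonneg (by norm_num))
  refine scalar_cmp a x b y hx hy ha1 hb1 hax hby fun T hT => ?_
  obtain ⟨K, hK⟩ := (hJ' T hT).2
  rw [← hK, Jfun_ptL]
  exact (hJ T hT).1 _

/-- Concavity of conditional entropy, for a uniform mixture. -/
theorem condEnt_concave {G : Type*} [Fintype G] [Nonempty G] (f : G → Matrix (B × E) (B × E) ℂ)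
    (hf : ∀ g, (f g).PosSemidef) (htr : ∀ g, (f g).trace = 1) (s : ℝ)
    (hs : ∀ g, vnEntropy (f g) - vnEntropy (ptL (f g)) = s) :
    s ≤ vnEntropy ((Fintype.card G : ℂ)⁻¹ • ∑ g, f g)
      - vnEntropy (ptL ((Fintype.card G : ℂ)⁻¹ • ∑ g, f g)) := by
  have hcard : (0 : ℝ) < Fintype.card G := by exact_mod_cast Fintype.card_pos
  have hcast : (Fintype.card G : ℂ)⁻¹ = (((Fintype.card G : ℝ)⁻¹ : ℝ) : ℂ) := by push_cast; rfl
  have hsumP : (∑ g, f g).PosSemidef := Matrix.posSemidef_sum _ fun g _ => hf g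
  have hσ : ((Fintype.card G : ℂ)⁻¹ • ∑ g, f g).PosSemidef := by
    refine hsumP.smul ?_
    rw [hcast]
    exact_mod_cast (inv_pos.2 hcard).le
  obtain ⟨σ, hσdef⟩ : ∃ σ, σ = (Fintype.card G : ℂ)⁻¹ • ∑ g, f g := ⟨_, rfl⟩
  rw [← hσdef] at hσ ⊢
  have hle : ∀ g, (((Fintype.card G : ℝ) : ℂ) • σ - f g).PosSemidef := by
    intro g
    classical
    have hne : (Fintype.card G : ℂ) ≠ 0 := by exact_mod_cast hcard.ne'
    rw [hσdef, smul_smul, Complex.ofReal_natCast, mul_inv_cancel₀ hne, one_smul,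
      ← Finset.add_sum_erase _ _ (Finset.mem_univ g), add_sub_cancel_left]
    exact Matrix.posSemidef_sum _ fun g _ => hf g
  have hd : ∀ g, s + Xent (f g) σ ≤ Xent (ptL (f g)) (ptL σ) := by
    intro g
    have := dpi (hf g) hσ (htr g) _ (hle g)
    have := hs g
    linarith
  have hsum := Finset.sum_le_sum fun g (_ : g ∈ Finset.univ) => hd g
  rw [Finset.sum_add_distrib, Finset.sum_const, Finset.card_univ, nsmul_eq_mul] at hsum
  have hsum' := mul_le_mul_of_nonneg_left hsum (inv_pos.2 hcard).le
  rw [mul_add, ← mul_assoc, inv_mul_cancel₀ hcard.ne', one_mul, ← Xent_sum, ← Xent_sum, ← hcast,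
    ← hσdef, ← ptL_sum, ← ptL_smul, ← hσdef, Xent_self hσ.1, Xent_self (ptL_posSemidef hσ).1] at hsum'
  linarith

end

theorem vnEntropy_roots {A : Matrix n n ℂ} (h : A.IsHermitian) :
    vnEntropy A = -(A.charpoly.roots.map fun z => z.re * Real.logb 2 z.re).sum := by
  unfold vnEntropy
  rw [dif_pos h, h.roots_charpoly_eq_eigenvalues, Multiset.map_map]
  rfl

theorem vnEntropy_mul_comm (M : Matrix n m ℂ) (N : Matrix m n ℂ) (h1 : (M * N).IsHermitian)
    (h2 : (N * M).IsHermitian) : vnEntropy (M * N) = vnEntropy (N * M) := by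
  rw [vnEntropy_roots h1, vnEntropy_roots h2]
  have h := congrArg Polynomial.roots (charpoly_mul_comm' M N)
  rw [Polynomial.roots_mul, Polynomial.roots_mul, Polynomial.roots_pow, Polynomial.roots_pow,
    Polynomial.roots_X] at h
  · have h' := congrArg (fun s : Multiset ℂ => (s.map fun z => z.re * Real.logb 2 z.re).sum) h
    simp only [Multiset.map_add, Multiset.sum_add, Multiset.map_nsmul, Multiset.sum_nsmul] at h'
    simpa using h'
  · exact mul_ne_zero (pow_ne_zero _ Polynomial.X_ne_zero) (charpoly_monic _).ne_zero
  · exact mul_ne_zero (pow_ne_zero _ Polynomial.X_ne_zero) (charpoly_monic _).ne_zero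

theorem vnEntropy_isometry (W : Matrix m n ℂ) (hW : Wᴴ * W = 1) {ρ : Matrix n n ℂ}
    (hρ : ρ.IsHermitian) : vnEntropy (W * ρ * Wᴴ) = vnEntropy ρ := by
  have h1 : ρ * Wᴴ * W = ρ := by rw [Matrix.mul_assoc, hW, Matrix.mul_one]
  rw [Matrix.mul_assoc, vnEntropy_mul_comm, h1]
  · rw [← Matrix.mul_assoc]; exact isHermitian_mul_mul_conjTranspose W hρ
  · rw [h1]; exact hρ

section
variable {A B E : Type*} [Fintype A] [DecidableEq A] [Fintype B] [DecidableEq B]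
  [Fintype E] [DecidableEq E]

/-- Reshaping of an operator `A → B ⊗ E` to an operator `B ⊗ A → E`. -/
def reshape (Y : Matrix (B × E) A ℂ) : Matrix E (B × A) ℂ := Matrix.of fun e x => Y (x.1, e) x.2

theorem reshape_mul (Y : Matrix (B × E) A ℂ) : reshape Y * (reshape Y)ᴴ = ptL (Y * Yᴴ) := by
  ext e e'
  simp [reshape, ptL, mul_apply, Fintype.sum_prod_type]

theorem reshape_mul' (Y : Matrix (B × E) A ℂ) (x y : B × A) :
    ((reshape Y)ᴴ * reshape Y) x y = ptR (Y * Matrix.single y.2 x.2 (1 : ℂ) * Yᴴ) y.1 x.1 := by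
  simp [reshape, ptR, mul_apply, Matrix.single_apply, ite_and, Finset.sum_ite_eq]
  exact Finset.sum_congr rfl fun _ _ => mul_comm _ _

theorem vnEntropy_ptL_cov (V : Matrix (B × E) A ℂ) (u : Matrix A A ℂ) (v : Matrix B B ℂ)
    (hv : vᴴ * v = 1)
    (hcov : ∀ X : Matrix A A ℂ, ptR (V * (u * X * uᴴ) * Vᴴ) = v * ptR (V * X * Vᴴ) * vᴴ)
    {ρ : Matrix A A ℂ} (hρ : ρ.PosSemidef) :
    vnEntropy (ptL (V * (u * ρ * uᴴ) * Vᴴ)) = vnEntropy (ptL (V * ρ * Vᴴ)) := by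
  obtain ⟨X, hX⟩ : ∃ X : Matrix A A ℂ, ρ = X * Xᴴ := by
    refine ⟨(hρ.1.eigenvectorUnitary : Matrix A A ℂ) *
      diagonal (fun i => ((Real.sqrt (hρ.1.eigenvalues i) : ℝ) : ℂ)), ?_⟩
    conv_lhs => rw [spec_eq hρ.1]
    rw [conjTranspose_mul, diagonal_conjTranspose, ← Matrix.mul_assoc, Matrix.mul_assoc _ (diagonal _) (diagonal _),
      diagonal_mul_diagonal]
    congr 3
    funext i
    have h0 := hρ.eigenvalues_nonneg i
    simp only [Pi.star_apply, Complex.star_def, Complex.conj_ofReal, ← Complex.ofReal_mul,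
      Real.mul_self_sqrt h0]
  have e1 : V * (u * ρ * uᴴ) * Vᴴ = (V * (u * X)) * (V * (u * X))ᴴ := by
    simp only [hX, Matrix.mul_assoc, conjTranspose_mul]
  have e2 : V * ρ * Vᴴ = (V * X) * (V * X)ᴴ := by
    simp only [hX, Matrix.mul_assoc, conjTranspose_mul]
  rw [e1, e2, ← reshape_mul, ← reshape_mul]
  rw [vnEntropy_mul_comm _ _ (isHermitian_mul_conjTranspose_self _) (isHermitian_conjTranspose_mul_self _),
    vnEntropy_mul_comm _ _ (isHermitian_mul_conjTranspose_self _) (isHermitian_conjTranspose_mul_self _)]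
  have hN : ((v.map star) ⊗ₖ (1 : Matrix A A ℂ))ᴴ * ((v.map star) ⊗ₖ (1 : Matrix A A ℂ)) = 1 := by
    rw [conjTranspose_kronecker, ← mul_kronecker_mul, conjTranspose_one, Matrix.one_mul]
    have : (v.map star)ᴴ * v.map star = 1 := by
      have h := congrArg (fun M : Matrix B B ℂ => M.map star) hv
      ext i j
      have h2 := congrFun (congrFun h i) j
      simp only [map_apply, mul_apply, star_sum, star_mul', conjTranspose_apply, star_star] at h2
      simp only [mul_apply, conjTranspose_apply, map_apply, star_star]
      rw [h2, one_apply]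
      split_ifs <;> simp
    rw [this, one_kronecker_one]
  rw [← vnEntropy_isometry _ hN (isHermitian_conjTranspose_mul_self (reshape (V * X)))]
  congr 1
  ext x y
  have e3 : V * (u * X) * Matrix.single y.2 x.2 (1 : ℂ) * (V * (u * X))ᴴ
      = V * (u * (X * Matrix.single y.2 x.2 (1 : ℂ) * Xᴴ) * uᴴ) * Vᴴ := by
    simp only [Matrix.mul_assoc, conjTranspose_mul]
  have e4 : ∀ a a', V * (X * Matrix.single a' a (1 : ℂ) * Xᴴ) * Vᴴ
      = (V * X) * Matrix.single a' a (1 : ℂ) * (V * X)ᴴ := by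
    intro a a'; simp only [Matrix.mul_assoc, conjTranspose_mul]
  rw [reshape_mul', e3, hcov, e4]
  have e5 : ∀ c c', ptR ((V * X) * Matrix.single y.2 x.2 (1 : ℂ) * (V * X)ᴴ) c' c
      = ((reshape (V * X))ᴴ * reshape (V * X)) (c, x.2) (c', y.2) := by
    intro c c'; rw [reshape_mul']
  obtain ⟨b, a⟩ := x
  obtain ⟨b', a'⟩ := y
  generalize (reshape (V * X))ᴴ * reshape (V * X) = R at e5 ⊢
  rw [conjTranspose_kronecker]
  simp only [mul_apply (M := v * _), mul_apply (M := v), e5, mul_apply (M := _ * R), mul_apply (N := R),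
    kronecker_apply, Fintype.sum_prod_type, one_apply, conjTranspose_apply, map_apply, star_star]
  simp [Finset.sum_mul, apply_ite star]
  rw [Finset.sum_comm]
  exact Finset.sum_congr rfl fun _ _ => Finset.sum_congr rfl fun _ _ => by ring

end

theorem avg_bound {G : Type*} [Group G] [Fintype G]
    {A B E : Type*} [Fintype A] [DecidableEq A]
    [Fintype B] [DecidableEq B] [Fintype E] [DecidableEq E]
    (u : G → Matrix A A ℂ) (v : G → Matrix B B ℂ)
    (hu : ∀ g, (u g)ᴴ * u g = 1) (hv : ∀ g, (v g)ᴴ * v g = 1)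
    (V : Matrix (B × E) A ℂ) (hV : Vᴴ * V = 1)
    (hcov : ∀ g (X : Matrix A A ℂ),
      ptR (V * (u g * X * (u g)ᴴ) * Vᴴ) = v g * ptR (V * X * Vᴴ) * (v g)ᴴ)
    (ρ : Matrix A A ℂ) (hρ : IsDensity ρ) :
    vnEntropy (V * ρ * Vᴴ) - vnEntropy (ptL (V * ρ * Vᴴ)) ≤
      vnEntropy (V * ((Fintype.card G : ℂ)⁻¹ • ∑ g, u g * ρ * (u g)ᴴ) * Vᴴ) -
        vnEntropy (ptL (V * ((Fintype.card G : ℂ)⁻¹ • ∑ g, u g * ρ * (u g)ᴴ) * Vᴴ)) := by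
  have hc : ∀ g, (u g * ρ * (u g)ᴴ).PosSemidef := fun g => hρ.1.mul_mul_conjTranspose_same (u g)
  have h := condEnt_concave (fun g => V * (u g * ρ * (u g)ᴴ) * Vᴴ)
    (fun g => (hc g).mul_mul_conjTranspose_same V)
    (fun g => by
      rw [Matrix.trace_mul_comm, ← Matrix.mul_assoc, hV, Matrix.one_mul, Matrix.trace_mul_comm,
        ← Matrix.mul_assoc, hu, Matrix.one_mul, hρ.2])
    (vnEntropy (V * ρ * Vᴴ) - vnEntropy (ptL (V * ρ * Vᴴ)))
    (fun g => by
      rw [vnEntropy_ptL_cov V (u g) (v g) (hv g) (hcov g) hρ.1, vnEntropy_isometry V hV (hc g).1,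
        vnEntropy_isometry (u g) (hu g) hρ.1.1, vnEntropy_isometry V hV hρ.1.1])
  rw [← Matrix.sum_mul, ← Matrix.mul_sum, ← Matrix.smul_mul, ← Matrix.mul_smul] at h
  exact h

theorem avg_density {G : Type*} [Group G] [Fintype G] {A : Type*} [Fintype A] [DecidableEq A]
    (u : G → Matrix A A ℂ) (hu : ∀ g, (u g)ᴴ * u g = 1) (ρ : Matrix A A ℂ) (hρ : IsDensity ρ) :
    IsDensity ((Fintype.card G : ℂ)⁻¹ • ∑ g, u g * ρ * (u g)ᴴ) := by
  have hne : (Fintype.card G : ℂ) ≠ 0 := by exact_mod_cast Fintype.card_ne_zero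
  constructor
  · refine (Matrix.posSemidef_sum _ fun g _ => hρ.1.mul_mul_conjTranspose_same (u g)).smul ?_
    have : (Fintype.card G : ℂ)⁻¹ = (((Fintype.card G : ℝ)⁻¹ : ℝ) : ℂ) := by push_cast; rfl
    rw [this]
    have h2 : (0 : ℝ) ≤ (Fintype.card G : ℝ)⁻¹ := by positivity
    exact_mod_cast h2
  · have : ∀ g, (u g * ρ * (u g)ᴴ).trace = 1 := fun g => by
      rw [Matrix.trace_mul_comm, ← Matrix.mul_assoc, hu, Matrix.one_mul, hρ.2]
    rw [Matrix.trace_smul, Matrix.trace_sum, Finset.sum_congr rfl fun g _ => this g]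
    simp [hne]

theorem avg_symm {G : Type*} [Group G] [Fintype G] {A : Type*} [Fintype A] [DecidableEq A]
    (u : G → Matrix A A ℂ) (huMul : ∀ g h, u (g * h) = u g * u h) (ρ : Matrix A A ℂ) :
    (Fintype.card G : ℂ)⁻¹ • ∑ g, u g * ρ * (u g)ᴴ = (Fintype.card G : ℂ)⁻¹ •
      ∑ h, u h * ((Fintype.card G : ℂ)⁻¹ • ∑ g, u g * ρ * (u g)ᴴ) * (u h)ᴴ := by
  have hne : (Fintype.card G : ℂ) ≠ 0 := by exact_mod_cast Fintype.card_ne_zero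
  have key : ∀ h, u h * ((Fintype.card G : ℂ)⁻¹ • ∑ g, u g * ρ * (u g)ᴴ) * (u h)ᴴ
      = (Fintype.card G : ℂ)⁻¹ • ∑ g, u g * ρ * (u g)ᴴ := by
    intro h
    rw [Matrix.mul_smul, Matrix.smul_mul, Matrix.mul_sum, Matrix.sum_mul]
    congr 1
    rw [← Equiv.sum_comp (Equiv.mulLeft h) (fun g => u g * ρ * (u g)ᴴ)]
    refine Finset.sum_congr rfl fun g _ => ?_
    simp only [Equiv.coe_mulLeft, huMul, conjTranspose_mul, Matrix.mul_assoc]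
  simp only [key]
  rw [Finset.sum_const, Finset.card_univ,
    ← Nat.cast_smul_eq_nsmul ℂ, smul_smul, inv_mul_cancel₀ hne, one_smul]

/-- If N is covariant with respect to a group G then the optimization in
−H(N) = sup_ρ H(B|E)_{U(ρ)} may be restricted to G-symmetrized inputs; in particular,
if the group average is the completely depolarizing map, the maximally mixed input is
optimal. -/
theorem covariant_channel_symmetrized_inputs
    {G : Type*} [Group G] [Fintype G]
    {A B E : Type*} [Fintype A] [DecidableEq A] [Nonempty A]
    [Fintype B] [DecidableEq B] [Fintype E] [DecidableEq E]
    (u : G → Matrix A A ℂ) (v : G → Matrix B B ℂ)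
    (hu : ∀ g, (u g)ᴴ * u g = 1) (hv : ∀ g, (v g)ᴴ * v g = 1)
    (huMul : ∀ g h, u (g * h) = u g * u h) (hvMul : ∀ g h, v (g * h) = v g * v h)
    (V : Matrix (B × E) A ℂ) (hV : Vᴴ * V = 1)
    (hcov : ∀ g (X : Matrix A A ℂ),
      ptR (V * (u g * X * (u g)ᴴ) * Vᴴ) = v g * ptR (V * X * Vᴴ) * (v g)ᴴ) :
    (sSup {x | ∃ ρ : Matrix A A ℂ, IsDensity ρ ∧
        x = vnEntropy (V * ρ * Vᴴ) - vnEntropy (ptL (V * ρ * Vᴴ))} =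
      sSup {x | ∃ ρ : Matrix A A ℂ, IsDensity ρ ∧
        ρ = (Fintype.card G : ℂ)⁻¹ • ∑ g, u g * ρ * (u g)ᴴ ∧
        x = vnEntropy (V * ρ * Vᴴ) - vnEntropy (ptL (V * ρ * Vᴴ))}) ∧
    ((∀ X : Matrix A A ℂ,
        (Fintype.card G : ℂ)⁻¹ • ∑ g, u g * X * (u g)ᴴ =
          X.trace • ((Fintype.card A : ℂ)⁻¹ • (1 : Matrix A A ℂ))) →
      sSup {x | ∃ ρ : Matrix A A ℂ, IsDensity ρ ∧
          x = vnEntropy (V * ρ * Vᴴ) - vnEntropy (ptL (V * ρ * Vᴴ))} =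
        vnEntropy (V * ((Fintype.card A : ℂ)⁻¹ • (1 : Matrix A A ℂ)) * Vᴴ) -
          vnEntropy (ptL (V * ((Fintype.card A : ℂ)⁻¹ • (1 : Matrix A A ℂ)) * Vᴴ))) := by
  constructor
  · refine csSup_eq_csSup_of_forall_exists_le ?_ ?_
    · rintro x ⟨ρ, hρ, rfl⟩
      exact ⟨_, ⟨_, avg_density u hu ρ hρ, avg_symm u huMul ρ, rfl⟩,
        avg_bound u v hu hv V hV hcov ρ hρ⟩
    · rintro x ⟨ρ, hρ, -, rfl⟩
      exact ⟨_, ⟨ρ, hρ, rfl⟩, le_rfl⟩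
  · intro hdep
    refine IsGreatest.csSup_eq ⟨⟨_, ?_, rfl⟩, ?_⟩
    · have hne : (Fintype.card A : ℂ) ≠ 0 := by exact_mod_cast Fintype.card_ne_zero
      constructor
      · refine Matrix.PosSemidef.one.smul ?_
        have : (Fintype.card A : ℂ)⁻¹ = (((Fintype.card A : ℝ)⁻¹ : ℝ) : ℂ) := by push_cast; rfl
        rw [this]
        have h2 : (0 : ℝ) ≤ (Fintype.card A : ℝ)⁻¹ := by positivity
        exact_mod_cast h2
      · rw [Matrix.trace_smul, Matrix.trace_one, smul_eq_mul, inv_mul_cancel₀ hne]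
    · rintro x ⟨ρ, hρ, rfl⟩
      have h := avg_bound u v hu hv V hV hcov ρ hρ
      rw [hdep, hρ.2, one_smul] at h
      exact h

end QCh
end

section
/- The max-mutual information of a channel is the α → ∞ limit of its sandwiched Rényi mutual information: I_max(N) = lim_{α→∞} I_α(N), where I_α(N) = max_{ψ_{RA}} min_{σ_B} D_α(N(ψ_{RA}) ‖ ψ_R ⊗ σ_B) and I_max(N) = max_{ψ_{RA}} min_{σ_B} D_max(N(ψ_{RA}) ‖ ψ_R ⊗ σ_B). -/
open Matrix BigOperators
open scoped Kronecker ComplexOrder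

namespace QCh

variable {n m : Type*} [Fintype n] [DecidableEq n] [Fintype m] [DecidableEq m]

open scoped Classical

/-- Sandwiched Rényi relative entropy of order α in bits (finite part). -/
noncomputable def sandD {A : Type*} [Fintype A] [DecidableEq A] (α : ℝ)
    (ρ σ : Matrix A A ℂ) : ℝ :=
  (1 / (α - 1)) * Real.logb 2
    ((matFun (fun x => x ^ α)
        (matFun (fun x => x ^ ((1 - α) / (2 * α))) σ * ρ *
          matFun (fun x => x ^ ((1 - α) / (2 * α))) σ)).trace.re)

/-- Extended-real-valued sandwiched Rényi relative entropy: +∞ for α > 1 when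
supp ρ ⊄ supp σ. -/
noncomputable def sandE {A : Type*} [Fintype A] [DecidableEq A] (α : ℝ)
    (ρ σ : Matrix A A ℂ) : EReal :=
  if α < 1 ∨ (∀ v : A → ℂ, σ *ᵥ v = 0 → ρ *ᵥ v = 0) then ((sandD α ρ σ : ℝ) : EReal)
  else ⊤

/-- Extended-real-valued max-relative entropy D_max(ρ‖σ) = inf {λ : ρ ≤ 2^λ σ}. -/
noncomputable def dMaxE {A : Type*} [Fintype A] [DecidableEq A]
    (ρ σ : Matrix A A ℂ) : EReal :=
  sInf ((fun l : ℝ => (l : EReal)) ''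
    {l : ℝ | ((((2 : ℝ) ^ l : ℝ) : ℂ) • σ - ρ).PosSemidef})

section helpers

lemma matFun_eq {f : ℝ → ℝ} {A U : Matrix n n ℂ} {d : n → ℝ}
    (h1 : Uᴴ * U = 1) (h2 : U * Uᴴ = 1)
    (hA : A = U * Matrix.diagonal (fun i => (d i : ℂ)) * Uᴴ) :
    matFun f A = U * Matrix.diagonal (fun i => (f (d i) : ℂ)) * Uᴴ := by
  have hH : A.IsHermitian := by
    rw [hA, Matrix.IsHermitian]
    simp only [conjTranspose_mul, conjTranspose_conjTranspose, diagonal_conjTranspose, mul_assoc]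
    congr 3
    ext i
    simp
  rw [matFun, dif_pos hH]
  have hs := hH.spectral_theorem
  rw [Unitary.conjStarAlgAut_apply] at hs
  set V : Matrix n n ℂ := (hH.eigenvectorUnitary : Matrix n n ℂ) with hV
  have v1 : star V * V = 1 := Unitary.coe_star_mul_self hH.eigenvectorUnitary
  have v2 : V * star V = 1 := Unitary.coe_mul_star_self hH.eigenvectorUnitary
  have e1 : Matrix.diagonal (fun i => (hH.eigenvalues i : ℂ)) * (star V * U)
      = (star V * U) * Matrix.diagonal (fun i => (d i : ℂ)) := by
    have : star V * A * U = star V * A * U := rfl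
    conv_lhs at this => rw [hs]
    conv_rhs at this => rw [hA]
    calc _ = (star V * V) * Matrix.diagonal (fun i => (hH.eigenvalues i : ℂ)) * (star V * U) := by
          rw [v1, one_mul]
      _ = star V * (V * Matrix.diagonal (RCLike.ofReal ∘ hH.eigenvalues) * star V) * U := by
          simp only [mul_assoc]; rfl
      _ = _ := this
      _ = (star V * U) * Matrix.diagonal (fun i => (d i : ℂ)) * (Uᴴ * U) := by
          simp only [mul_assoc]
      _ = _ := by rw [h1, mul_one]
  have e2 : Matrix.diagonal (fun i => (f (hH.eigenvalues i) : ℂ)) * (star V * U)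
      = (star V * U) * Matrix.diagonal (fun i => (f (d i) : ℂ)) := by
    ext i j
    have := congrFun (congrFun e1 i) j
    rw [diagonal_mul, mul_diagonal] at this ⊢
    by_cases hz : (star V * U) i j = 0
    · simp [hz]
    · have h3 : (hH.eigenvalues i : ℂ) = d j := by
        rw [mul_comm] at this
        exact mul_left_cancel₀ hz this
      have h4 : hH.eigenvalues i = d j := by exact_mod_cast h3
      rw [h4, mul_comm]
  calc _ = V * (Matrix.diagonal (fun i => (f (hH.eigenvalues i) : ℂ)) * (star V * U)) * Uᴴ := by
        simp only [mul_assoc]; rw [h2, mul_one]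
    _ = (V * star V) * U * Matrix.diagonal (fun i => (f (d i) : ℂ)) * Uᴴ := by
        rw [e2]; simp only [mul_assoc]
    _ = _ := by rw [v2, one_mul]

lemma exists_spec {A : Matrix n n ℂ} (hA : A.PosSemidef) :
    ∃ (U : Matrix n n ℂ) (d : n → ℝ), Uᴴ * U = 1 ∧ U * Uᴴ = 1 ∧
      A = U * Matrix.diagonal (fun i => (d i : ℂ)) * Uᴴ ∧ (∀ i, 0 ≤ d i) ∧
      A.trace = ((∑ i, d i : ℝ) : ℂ) := by
  have hs := hA.1.spectral_theorem
  rw [Unitary.conjStarAlgAut_apply] at hs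
  refine ⟨hA.1.eigenvectorUnitary, hA.1.eigenvalues, Unitary.coe_star_mul_self _,
    Unitary.coe_mul_star_self _, hs, hA.eigenvalues_nonneg, ?_⟩
  rw [hA.1.trace_eq_sum_eigenvalues]
  simp

lemma trace_conj {U : Matrix n n ℂ} {d : n → ℝ} (h1 : Uᴴ * U = 1) :
    (U * Matrix.diagonal (fun i => (d i : ℂ)) * Uᴴ).trace = ((∑ i, d i : ℝ) : ℂ) := by
  rw [mul_assoc, trace_mul_comm, mul_assoc, h1, mul_one, trace_diagonal]
  simp

lemma psd_conj {U : Matrix n n ℂ} {d : n → ℝ} (hd : ∀ i, 0 ≤ d i) :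
    (U * Matrix.diagonal (fun i => (d i : ℂ)) * Uᴴ).PosSemidef := by
  apply PosSemidef.mul_mul_conjTranspose_same
  rw [posSemidef_diagonal_iff]
  intro i
  exact_mod_cast hd i

/-- Difference of two matrices diagonal in the same basis. -/
lemma psd_conj_sub {U : Matrix n n ℂ} {d e : n → ℝ} (c : ℝ) (hd : ∀ i, e i ≤ c * d i) :
    ((c : ℂ) • (U * Matrix.diagonal (fun i => (d i : ℂ)) * Uᴴ)
      - U * Matrix.diagonal (fun i => (e i : ℂ)) * Uᴴ).PosSemidef := by
  have := psd_conj (U := U) (d := fun i => c * d i - e i) (fun i => sub_nonneg.2 (hd i))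
  convert this using 1
  rw [← smul_mul_assoc, ← mul_smul_comm, ← sub_mul, ← mul_sub]
  congr 2
  ext i j
  by_cases h : i = j
  · subst h; simp
  · simp [h]

lemma trace_pow_le {X : Matrix n n ℂ} (hX : X.PosSemidef) {c α : ℝ} (hα : 0 < α)
    (hc : ((c : ℂ) • (1 : Matrix n n ℂ) - X).PosSemidef) :
    (matFun (fun x => x ^ α) X).trace.re ≤ Fintype.card n * c ^ α := by
  obtain ⟨U, d, h1, h2, rfl, hd, -⟩ := exists_spec hX
  rw [matFun_eq h1 h2 rfl, trace_conj h1, Complex.ofReal_re]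
  have hle : ∀ i, d i ≤ c := by
    intro i
    have h3 := hc.conjTranspose_mul_mul_same U
    have h4 : Uᴴ * ((c : ℂ) • (1 : Matrix n n ℂ)
        - U * Matrix.diagonal (fun i => (d i : ℂ)) * Uᴴ) * U
        = Matrix.diagonal (fun i => ((c - d i : ℝ) : ℂ)) := by
      rw [mul_sub, sub_mul, mul_smul_comm, mul_one, smul_mul_assoc, h1]
      have : Uᴴ * (U * Matrix.diagonal (fun i => (d i : ℂ)) * Uᴴ) * U
        = (Uᴴ * U) * Matrix.diagonal (fun i => (d i : ℂ)) * (Uᴴ * U) := by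
        simp only [mul_assoc]
      rw [this, h1, one_mul, mul_one]
      ext i j
      by_cases h : i = j
      · subst h; simp
      · simp [h]
    rw [h4, posSemidef_diagonal_iff] at h3
    have := h3 i
    have h5 : (0 : ℝ) ≤ c - d i := by exact_mod_cast this
    linarith
  calc ∑ i, d i ^ α ≤ ∑ i : n, c ^ α :=
        Finset.sum_le_sum fun i _ => Real.rpow_le_rpow (hd i) (hle i) hα.le
    _ = _ := by simp

lemma exists_top_eig [Nonempty n] {X : Matrix n n ℂ} (hX : X.PosSemidef) (hX0 : X ≠ 0) :
    ∃ μ : ℝ, 0 < μ ∧ ((μ : ℂ) • (1 : Matrix n n ℂ) - X).PosSemidef ∧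
      ∀ α : ℝ, μ ^ α ≤ (matFun (fun x => x ^ α) X).trace.re := by
  obtain ⟨U, d, h1, h2, rfl, hd, -⟩ := exists_spec hX
  obtain ⟨i0, hi0⟩ := Finite.exists_max d
  refine ⟨d i0, ?_, ?_, ?_⟩
  · rcases (hd i0).lt_or_eq with h | h
    · exact h
    · exfalso; apply hX0
      have : ∀ i, d i = 0 := fun i => le_antisymm (by rw [h]; exact hi0 i) (hd i)
      simp [this]
  · have := psd_conj_sub (U := U) (d := fun _ => 1) (e := d) (d i0) (by simpa using hi0)
    simpa [h2] using this
  · intro α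
    rw [matFun_eq h1 h2 rfl, trace_conj h1, Complex.ofReal_re]
    exact Finset.single_le_sum (f := fun i => d i ^ α)
      (fun i _ => Real.rpow_nonneg (hd i) _) (Finset.mem_univ i0)

/-- Products of matrices diagonal in the same basis. -/
lemma conj_mul_conj {U : Matrix n n ℂ} {d e : n → ℝ} (h1 : Uᴴ * U = 1) :
    (U * Matrix.diagonal (fun i => (d i : ℂ)) * Uᴴ) *
      (U * Matrix.diagonal (fun i => (e i : ℂ)) * Uᴴ)
      = U * Matrix.diagonal (fun i => ((d i * e i : ℝ) : ℂ)) * Uᴴ := by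
  calc _ = U * Matrix.diagonal (fun i => (d i : ℂ)) * (Uᴴ * U) *
        Matrix.diagonal (fun i => (e i : ℂ)) * Uᴴ := by simp only [mul_assoc]
    _ = U * (Matrix.diagonal (fun i => (d i : ℂ)) * Matrix.diagonal (fun i => (e i : ℂ))) * Uᴴ := by
      rw [h1, mul_one]; simp only [mul_assoc]
    _ = _ := by rw [diagonal_mul_diagonal]; simp

lemma herm_conj {U : Matrix n n ℂ} {d : n → ℝ} :
    (U * Matrix.diagonal (fun i => (d i : ℂ)) * Uᴴ)ᴴ
      = U * Matrix.diagonal (fun i => (d i : ℂ)) * Uᴴ := by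
  simp only [conjTranspose_mul, conjTranspose_conjTranspose, diagonal_conjTranspose, mul_assoc]
  congr 3
  ext i
  simp

/-- support projection acts trivially -/
lemma supp_absorb {ρ U : Matrix n n ℂ} {d e : n → ℝ} (h1 : Uᴴ * U = 1)
    (he : ∀ i, d i ≠ 0 → e i = 1)
    (hs : ∀ v : n → ℂ, (U * Matrix.diagonal (fun i => (d i : ℂ)) * Uᴴ) *ᵥ v = 0 → ρ *ᵥ v = 0) :
    ρ * (U * Matrix.diagonal (fun i => (e i : ℂ)) * Uᴴ) = ρ := by
  have hz : (U * Matrix.diagonal (fun i => (d i : ℂ)) * Uᴴ) *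
      (1 - U * Matrix.diagonal (fun i => (e i : ℂ)) * Uᴴ) = 0 := by
    rw [mul_sub, mul_one, conj_mul_conj h1, sub_eq_zero]
    congr 3
    ext i
    by_cases h : d i = 0
    · simp [h]
    · simp [he i h]
  have hρ : ρ * (1 - U * Matrix.diagonal (fun i => (e i : ℂ)) * Uᴴ) = 0 := by
    ext i j
    have h3 : (U * Matrix.diagonal (fun i => (d i : ℂ)) * Uᴴ) *ᵥ
      ((1 - U * Matrix.diagonal (fun i => (e i : ℂ)) * Uᴴ).col j) = 0 := by
      ext k
      exact congrFun (congrFun hz k) j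
    exact congrFun (hs _ h3) i
  rw [mul_sub, mul_one, sub_eq_zero] at hρ
  exact hρ.symm

lemma supp_of_le {ρ τ : Matrix n n ℂ} (hρ : ρ.PosSemidef) {c : ℝ}
    (h : ((c : ℂ) • τ - ρ).PosSemidef) (v : n → ℂ) (hv : τ *ᵥ v = 0) : ρ *ᵥ v = 0 := by
  rw [← hρ.dotProduct_mulVec_zero_iff]
  apply le_antisymm _ (hρ.dotProduct_mulVec_nonneg v)
  have := h.dotProduct_mulVec_nonneg v
  rw [sub_mulVec, smul_mulVec, hv, smul_zero, zero_sub, dotProduct_neg] at this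
  exact neg_nonneg.1 this

lemma psd_mono {ρ τ : Matrix n n ℂ} (hτ : τ.PosSemidef) {c c' : ℝ} (hcc : c ≤ c')
    (h : ((c : ℂ) • τ - ρ).PosSemidef) : ((c' : ℂ) • τ - ρ).PosSemidef := by
  have a2 := (hτ.smul (show (0 : ℂ) ≤ ((c' - c : ℝ) : ℂ) by
    exact_mod_cast sub_nonneg.2 hcc)).add h
  convert a2 using 1
  rw [Complex.ofReal_sub, sub_smul]
  abel

/-- Upper estimate: `ρ ≤ 2^r τ` bounds the sandwiched divergence. -/
lemma sandE_le [Nonempty n] {ρ τ U : Matrix n n ℂ} {d : n → ℝ} (hρ : ρ.PosSemidef) (hρ0 : ρ ≠ 0)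
    (h1 : Uᴴ * U = 1) (h2 : U * Uᴴ = 1)
    (hτ : τ = U * Matrix.diagonal (fun i => (d i : ℂ)) * Uᴴ)
    (hd : ∀ i, 0 ≤ d i) (hd1 : ∀ i, d i ≤ 1) {r α : ℝ} (hα : 1 < α)
    (h : ((((2 : ℝ) ^ r : ℝ) : ℂ) • τ - ρ).PosSemidef) :
    sandE α ρ τ ≤ (((r * α + Real.logb 2 (Fintype.card n)) / (α - 1) : ℝ) : EReal) := by
  have hs := supp_of_le hρ h
  rw [sandE, if_pos (Or.inr hs), EReal.coe_le_coe_iff, sandD]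
  set s : ℝ := (1 - α) / (2 * α) with hsdef
  have hsneg : s < 0 := div_neg_of_neg_of_pos (by linarith) (by linarith)
  rw [matFun_eq h1 h2 hτ]
  set T := U * Matrix.diagonal (fun i => ((d i ^ s : ℝ) : ℂ)) * Uᴴ with hT
  have hTH : Tᴴ = T := herm_conj (d := fun i => d i ^ s)
  have hX : (T * ρ * T).PosSemidef := by
    have := hρ.mul_mul_conjTranspose_same T
    rwa [hTH] at this
  have hX0 : T * ρ * T ≠ 0 := by
    intro h0
    apply hρ0
    set S := U * Matrix.diagonal (fun i => ((d i ^ (-s) : ℝ) : ℂ)) * Uᴴ with hS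
    have hSH : Sᴴ = S := herm_conj (d := fun i => d i ^ (-s))
    have e1 : ρ * (T * S) = ρ := by
      rw [hT, hS, conj_mul_conj (d := fun i => d i ^ s) (e := fun i => d i ^ (-s)) h1]
      refine supp_absorb h1 (d := d) (e := fun i => d i ^ s * d i ^ (-s)) ?_ (hτ ▸ hs)
      intro i hi
      have : 0 < d i := lt_of_le_of_ne (hd i) (Ne.symm hi)
      rw [← Real.rpow_add this]; simp
    have e2 : (S * T) * ρ = ρ := by
      have := congrArg conjTranspose e1
      rwa [conjTranspose_mul, conjTranspose_mul, hTH, hSH, hρ.1] at this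
    calc ρ = (S * T) * (ρ * (T * S)) := by rw [e1, e2]
      _ = S * (T * ρ * T) * S := by simp only [mul_assoc]
      _ = 0 := by rw [h0]; simp
  have hc : ((((2 : ℝ) ^ r : ℝ) : ℂ) • (1 : Matrix n n ℂ) - T * ρ * T).PosSemidef := by
    have a1 := h.mul_mul_conjTranspose_same T
    rw [hTH, mul_sub, sub_mul, mul_smul_comm, smul_mul_assoc] at a1
    have a2 : T * τ * T = U * Matrix.diagonal (fun i => ((d i ^ s * d i * d i ^ s : ℝ) : ℂ)) * Uᴴ := by
      rw [hT, hτ, conj_mul_conj (d := fun i => d i ^ s) (e := d) h1,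
        conj_mul_conj (d := fun i => d i ^ s * d i) (e := fun i => d i ^ s) h1]
    have a3 := psd_conj_sub (U := U) (d := fun _ => (2 : ℝ) ^ r)
      (e := fun i => (2 : ℝ) ^ r * (d i ^ s * d i * d i ^ s)) 1 (by
      intro i
      have : d i ^ s * d i * d i ^ s ≤ 1 := by
        rcases (hd i).lt_or_eq with hp | hp
        · have : d i ^ s * d i * d i ^ s = d i ^ (1 + 2 * s) := by
            rw [Real.rpow_add hp, two_mul, Real.rpow_add hp, Real.rpow_one]; ring
          rw [this]
          apply Real.rpow_le_one (hd i) (hd1 i)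
          have : 1 + 2 * s = 1 / α := by rw [hsdef]; field_simp; ring
          rw [this]; positivity
        · rw [← hp]; simp
      have h3 : (0 : ℝ) < 2 ^ r := by positivity
      nlinarith)
    have a4 := a3.add a1
    rw [a2] at a4
    convert a4 using 1
    have b1 : U * Matrix.diagonal (fun _ => (((2 : ℝ) ^ r : ℝ) : ℂ)) * Uᴴ
        = (((2 : ℝ) ^ r : ℝ) : ℂ) • (1 : Matrix n n ℂ) := by
      rw [← h2, ← smul_one_eq_diagonal]; simp
    have b2 : U * Matrix.diagonal (fun i => (((2 : ℝ) ^ r * (d i ^ s * d i * d i ^ s) : ℝ) : ℂ)) * Uᴴ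
        = (((2 : ℝ) ^ r : ℝ) : ℂ) •
          (U * Matrix.diagonal (fun i => ((d i ^ s * d i * d i ^ s : ℝ) : ℂ)) * Uᴴ) := by
      rw [← smul_mul_assoc, ← mul_smul_comm]
      congr 2
      ext i j
      by_cases h : i = j
      · subst h; simp
      · simp [h]
    rw [b1, b2]
    simp
  have hle := trace_pow_le hX (α := α) (by linarith) hc
  obtain ⟨μ, hμ, -, hμ2⟩ := exists_top_eig hX hX0
  have hpos : 0 < (matFun (fun x => x ^ α) (T * ρ * T)).trace.re :=
    lt_of_lt_of_le (Real.rpow_pos_of_pos hμ α) (hμ2 α)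
  have hcard : (0 : ℝ) < Fintype.card n := by exact_mod_cast Fintype.card_pos
  have hlog := Real.logb_le_logb_of_le (b := 2) (by norm_num) hpos hle
  rw [Real.logb_mul hcard.ne' (by positivity), ← Real.rpow_mul (by norm_num),
    Real.logb_rpow (by norm_num) (by norm_num)] at hlog
  rw [one_div, inv_mul_eq_div]
  apply div_le_div_of_nonneg_right _ (by linarith)
  linarith

/-- Lower estimate: `ρ ≤ μ τ^{1-1/α}` with `log μ ≤ (α-1)/α D_α`. -/
lemma exists_le_pow [Nonempty n] {ρ τ U : Matrix n n ℂ} {d : n → ℝ}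
    (hρ : ρ.PosSemidef) (hρ0 : ρ ≠ 0)
    (h1 : Uᴴ * U = 1) (h2 : U * Uᴴ = 1)
    (hτ : τ = U * Matrix.diagonal (fun i => (d i : ℂ)) * Uᴴ)
    (hd : ∀ i, 0 ≤ d i) {α : ℝ} (hα : 1 < α)
    (hs : ∀ v : n → ℂ, τ *ᵥ v = 0 → ρ *ᵥ v = 0) :
    ∃ μ : ℝ, 0 < μ ∧ α * Real.logb 2 μ ≤ (α - 1) * sandD α ρ τ ∧
      ((μ : ℂ) • (U * Matrix.diagonal (fun i => ((d i ^ (1 - 1 / α) : ℝ) : ℂ)) * Uᴴ) - ρ).PosSemidef := by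
  rw [sandD]
  set s : ℝ := (1 - α) / (2 * α) with hsdef
  have hsneg : s < 0 := div_neg_of_neg_of_pos (by linarith) (by linarith)
  rw [matFun_eq h1 h2 hτ]
  set T := U * Matrix.diagonal (fun i => ((d i ^ s : ℝ) : ℂ)) * Uᴴ with hT
  have hTH : Tᴴ = T := herm_conj (d := fun i => d i ^ s)
  have hX : (T * ρ * T).PosSemidef := by
    have := hρ.mul_mul_conjTranspose_same T
    rwa [hTH] at this
  set S := U * Matrix.diagonal (fun i => ((d i ^ (-s) : ℝ) : ℂ)) * Uᴴ with hS
  have hSH : Sᴴ = S := herm_conj (d := fun i => d i ^ (-s))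
  have e1 : ρ * (T * S) = ρ := by
    rw [hT, hS, conj_mul_conj (d := fun i => d i ^ s) (e := fun i => d i ^ (-s)) h1]
    refine supp_absorb h1 (d := d) (e := fun i => d i ^ s * d i ^ (-s)) ?_ (hτ ▸ hs)
    intro i hi
    have : 0 < d i := lt_of_le_of_ne (hd i) (Ne.symm hi)
    rw [← Real.rpow_add this]; simp
  have e2 : (S * T) * ρ = ρ := by
    have := congrArg conjTranspose e1
    rwa [conjTranspose_mul, conjTranspose_mul, hTH, hSH, hρ.1] at this
  have e3 : S * (T * ρ * T) * S = ρ := by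
    calc _ = (S * T) * (ρ * (T * S)) := by simp only [mul_assoc]
      _ = ρ := by rw [e1, e2]
  have hX0 : T * ρ * T ≠ 0 := by
    intro h0
    apply hρ0
    rw [← e3, h0]; simp
  obtain ⟨μ, hμ, hμ1, hμ2⟩ := exists_top_eig hX hX0
  refine ⟨μ, hμ, ?_, ?_⟩
  · have hlog := Real.logb_le_logb_of_le (b := 2) (by norm_num) (Real.rpow_pos_of_pos hμ α) (hμ2 α)
    rw [Real.logb_rpow_eq_mul_logb_of_pos hμ] at hlog
    have : α - 1 ≠ 0 := by linarith
    rw [← mul_assoc, mul_one_div_cancel this, one_mul]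
    exact hlog
  · have a1 := hμ1.mul_mul_conjTranspose_same S
    rw [hSH, mul_sub, sub_mul, mul_smul_comm, smul_mul_assoc, mul_one, e3, hS,
      conj_mul_conj (d := fun i => d i ^ (-s)) (e := fun i => d i ^ (-s)) h1] at a1
    convert a1 using 6
    ext i
    congr 1
    have h3 : 1 - 1 / α = -s + -s := by rw [hsdef]; field_simp; ring
    have h4 : 0 < -s := by linarith
    rw [h3]
    rw [Real.rpow_add_of_nonneg (hd i) h4.le h4.le]

lemma sum_pow_le [Nonempty n] {b : n → ℝ} (hb : ∀ i, 0 ≤ b i) (hb1 : ∑ i, b i = 1)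
    {α : ℝ} (hα : 1 < α) :
    ∑ i, b i ^ (1 - 1 / α) ≤ (Fintype.card n : ℝ) ^ (1 / α) := by
  set t : ℝ := 1 - 1 / α with ht
  have hα1 : 1 / α < 1 := by rw [div_lt_one (by linarith)]; exact hα
  have hα0 : 0 < 1 / α := by positivity
  have ht0 : 0 < t := by linarith
  have ht1 : t ≤ 1 := by linarith
  have h := Real.rpow_sum_le_const_mul_sum_rpow (Finset.univ) (fun i => b i ^ t)
    (p := 1 / t) (by rw [le_div_iff₀ ht0]; linarith)
  have e : ∀ i, |b i ^ t| = b i ^ t := fun i => abs_of_nonneg (Real.rpow_nonneg (hb i) _)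
  have e' : ∀ i, (b i ^ t) ^ (1 / t) = b i := fun i => by
    rw [← Real.rpow_mul (hb i), mul_one_div_cancel ht0.ne', Real.rpow_one]
  simp only [e, e', hb1, mul_one, Finset.card_univ] at h
  have hS : 0 ≤ ∑ i, b i ^ t := Finset.sum_nonneg fun i _ => Real.rpow_nonneg (hb i) _
  have h' := Real.rpow_le_rpow (Real.rpow_nonneg hS _) h ht0.le
  rw [← Real.rpow_mul hS, one_div_mul_cancel ht0.ne', Real.rpow_one,
    ← Real.rpow_mul (by positivity)] at h'
  have : (1 / t - 1) * t = 1 / α := by rw [sub_mul, one_div_mul_cancel ht0.ne', ht]; ring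
  rwa [this] at h'

lemma kron_conj {U : Matrix n n ℂ} {V : Matrix m m ℂ} {a : n → ℝ} {b : m → ℝ} :
    (U * Matrix.diagonal (fun i => (a i : ℂ)) * Uᴴ) ⊗ₖ (V * Matrix.diagonal (fun i => (b i : ℂ)) * Vᴴ)
     = (U ⊗ₖ V) * Matrix.diagonal (fun p : n × m => ((a p.1 * b p.2 : ℝ) : ℂ)) * (U ⊗ₖ V)ᴴ := by
  rw [mul_kronecker_mul, mul_kronecker_mul, diagonal_kronecker_diagonal, conjTranspose_kronecker]
  simp

lemma kron_unit {U : Matrix n n ℂ} {V : Matrix m m ℂ} (h1 : U * Uᴴ = 1) (h2 : V * Vᴴ = 1) :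
    (U ⊗ₖ V) * (U ⊗ₖ V)ᴴ = 1 := by
  rw [conjTranspose_kronecker, ← mul_kronecker_mul, h1, h2, one_kronecker_one]

lemma kron_unit' {U : Matrix n n ℂ} {V : Matrix m m ℂ} (h1 : Uᴴ * U = 1) (h2 : Vᴴ * V = 1) :
    (U ⊗ₖ V)ᴴ * (U ⊗ₖ V) = 1 := by
  rw [conjTranspose_kronecker, ← mul_kronecker_mul, h1, h2, one_kronecker_one]

lemma exists_kappa (a : n → ℝ) (ha : ∀ i, 0 ≤ a i) :
    ∃ κ : ℝ, 0 < κ ∧ ∀ i, a i ≠ 0 → κ ≤ a i := by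
  by_cases hne : (Finset.univ.filter fun i => a i ≠ 0).Nonempty
  · obtain ⟨i, hi, hmin⟩ := Finset.exists_min_image _ a hne
    simp only [Finset.mem_filter, Finset.mem_univ, true_and] at hi hmin
    exact ⟨a i, lt_of_le_of_ne (ha i) (Ne.symm hi), fun j hj => hmin j hj⟩
  · refine ⟨1, one_pos, fun i hi => absurd ⟨i, by simpa using hi⟩ hne⟩

/-- Main lower estimate, for a fixed marginal `ω`. -/
lemma lower_bound [Nonempty n] [Nonempty m] {ω : Matrix n n ℂ} {ρ : Matrix (n × m) (n × m) ℂ}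
    (hρ : ρ.PosSemidef) (hρ0 : ρ ≠ 0) (hω : ω.PosSemidef) :
    ∃ C : ℝ, ∀ α : ℝ, 1 < α → ∀ σ : Matrix m m ℂ, IsDensity σ →
      (∀ v, (ω ⊗ₖ σ) *ᵥ v = 0 → ρ *ᵥ v = 0) →
      ∃ σ' : Matrix m m ℂ, IsDensity σ' ∧
        dMaxE ρ (ω ⊗ₖ σ') ≤ ((((α - 1) * sandD α ρ (ω ⊗ₖ σ) + C) / α : ℝ) : EReal) := by
  obtain ⟨U, a, u1, u2, hωe, ha, -⟩ := exists_spec hω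
  obtain ⟨κ, hκ, hκa⟩ := exists_kappa a ha
  have hcard : (0 : ℝ) < Fintype.card m := by exact_mod_cast Fintype.card_pos
  refine ⟨Real.logb 2 (Fintype.card m / κ), ?_⟩
  intro α hα σ hσ hs
  obtain ⟨V, b, v1, v2, hσe, hb, hbt⟩ := exists_spec hσ.1
  have hb1 : ∑ i, b i = 1 := by
    rw [hσ.2] at hbt; exact_mod_cast hbt.symm
  have hα0 : 0 < 1 / α := by positivity
  have hα1 : 1 / α < 1 := by rw [div_lt_one (by linarith)]; exact hα
  obtain ⟨μ, hμ, hμl, hμp⟩ := exists_le_pow (U := U ⊗ₖ V) (d := fun p => a p.1 * b p.2) (τ := ω ⊗ₖ σ)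
    hρ hρ0 (kron_unit' u1 v1) (kron_unit u2 v2) (by rw [hωe, hσe, kron_conj])
    (fun p => mul_nonneg (ha _) (hb _)) hα hs
  set t : ℝ := 1 - 1 / α with ht
  have hSle := sum_pow_le hb hb1 hα
  rw [← ht] at hSle
  set S : ℝ := ∑ i, b i ^ t with hSdef
  have hS : 0 < S := by
    have : ∃ i, b i ≠ 0 := by
      by_contra hcon
      push Not at hcon
      simp [hcon] at hb1
    obtain ⟨i, hi⟩ := this
    exact Finset.sum_pos' (fun i _ => Real.rpow_nonneg (hb i) _)
      ⟨i, Finset.mem_univ _, Real.rpow_pos_of_pos (lt_of_le_of_ne (hb i) (Ne.symm hi)) _⟩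
  set σ' : Matrix m m ℂ := V * Matrix.diagonal (fun i => ((b i ^ t / S : ℝ) : ℂ)) * Vᴴ with hσ'
  have hσd : IsDensity σ' := by
    refine ⟨psd_conj fun i => div_nonneg (Real.rpow_nonneg (hb i) _) hS.le, ?_⟩
    rw [hσ', trace_conj (d := fun i => b i ^ t / S) v1, ← Finset.sum_div, ← hSdef, div_self hS.ne']
    simp
  refine ⟨σ', hσd, ?_⟩
  set c : ℝ := (Fintype.card m / κ) ^ (1 / α) with hc
  have hc0 : 0 < c := by positivity
  have key : ∀ p : n × m, (a p.1 * b p.2) ^ t ≤ c * (a p.1 * (b p.2 ^ t / S)) := by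
    intro p
    rcases (ha p.1).lt_or_eq with hp | hp
    · rw [Real.mul_rpow (ha _) (hb _)]
      have h3 : a p.1 ^ t ≤ a p.1 * κ ^ (-(1 / α)) := by
        rw [ht, sub_eq_add_neg, Real.rpow_add hp, Real.rpow_one]
        exact mul_le_mul_of_nonneg_left
          (Real.rpow_le_rpow_of_nonpos hκ (hκa _ hp.ne') (by linarith)) hp.le
      have h4 : b p.2 ^ t ≤ (Fintype.card m : ℝ) ^ (1 / α) * (b p.2 ^ t / S) := by
        rw [mul_div_assoc', le_div_iff₀ hS, mul_comm]
        exact mul_le_mul_of_nonneg_right hSle (Real.rpow_nonneg (hb _) _)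
      calc _ ≤ (a p.1 * κ ^ (-(1 / α))) * ((Fintype.card m : ℝ) ^ (1 / α) * (b p.2 ^ t / S)) :=
            mul_le_mul h3 h4 (Real.rpow_nonneg (hb _) _) (by positivity)
        _ = _ := by
            rw [hc, Real.div_rpow hcard.le hκ.le, Real.rpow_neg hκ.le]; ring
    · rw [← hp]
      have : t ≠ 0 := by linarith
      simp [Real.zero_rpow this]
  have hfin : (((μ * c : ℝ) : ℂ) • (ω ⊗ₖ σ') - ρ).PosSemidef := by
    have a1 := psd_conj_sub (U := U ⊗ₖ V) (d := fun p => a p.1 * (b p.2 ^ t / S))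
      (e := fun p => (a p.1 * b p.2) ^ t) c key
    have a2 := a1.smul (show (0 : ℂ) ≤ (μ : ℂ) by exact_mod_cast hμ.le)
    have a3 := a2.add hμp
    rw [smul_sub, sub_add_sub_cancel, smul_smul] at a3
    rw [hσ', hωe, kron_conj (b := fun i => b i ^ t / S), Complex.ofReal_mul]
    exact a3
  apply sInf_le
  refine ⟨_, ?_, rfl⟩
  have hval : Real.logb 2 (μ * c) ≤ ((α - 1) * sandD α ρ (ω ⊗ₖ σ)
      + Real.logb 2 (Fintype.card m / κ)) / α := by
    rw [Real.logb_mul hμ.ne' hc0.ne', hc, Real.logb_rpow_eq_mul_logb_of_pos (by positivity),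
      le_div_iff₀ (by linarith)]
    have : (1 / α * Real.logb 2 (Fintype.card m / κ)) * α = Real.logb 2 (Fintype.card m / κ) := by
      field_simp
    linarith
  have hge : μ * c ≤ (2 : ℝ) ^ (((α - 1) * sandD α ρ (ω ⊗ₖ σ)
      + Real.logb 2 (Fintype.card m / κ)) / α) := by
    rw [← Real.logb_le_iff_le_rpow (by norm_num) (by positivity)]
    exact hval
  exact psd_mono (hω.kronecker hσd.1) hge hfin

end helpers

section channel

variable {A B ι : Type} [Fintype A] [DecidableEq A] [Fintype B] [DecidableEq B] [Fintype ι]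

lemma ext_eq (K : ι → Matrix B A ℂ) (ψ : Matrix (A × A) (A × A) ℂ) :
    ext (krausMap K) ψ = ∑ i, ((1 : Matrix A A ℂ) ⊗ₖ K i) * ψ * ((1 : Matrix A A ℂ) ⊗ₖ K i)ᴴ := by
  funext p q
  obtain ⟨p1, p2⟩ := p
  obtain ⟨q1, q2⟩ := q
  simp only [ext, krausMap, of_apply, Matrix.sum_apply]
  refine Finset.sum_congr rfl fun i _ => ?_
  simp [mul_apply, Fintype.sum_prod_type, one_apply, Finset.sum_ite_eq, ite_mul, apply_ite star]

lemma ext_psd (K : ι → Matrix B A ℂ) {ψ : Matrix (A × A) (A × A) ℂ} (hψ : ψ.PosSemidef) :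
    (ext (krausMap K) ψ).PosSemidef := by
  rw [ext_eq]
  exact posSemidef_sum _ fun i _ => hψ.mul_mul_conjTranspose_same _

lemma ext_trace (K : ι → Matrix B A ℂ) (hK : ∑ i, (K i)ᴴ * K i = 1)
    (ψ : Matrix (A × A) (A × A) ℂ) : (ext (krausMap K) ψ).trace = ψ.trace := by
  rw [ext_eq, trace_sum]
  have : ∀ i, (((1 : Matrix A A ℂ) ⊗ₖ K i) * ψ * ((1 : Matrix A A ℂ) ⊗ₖ K i)ᴴ).trace
      = (((1 : Matrix A A ℂ) ⊗ₖ ((K i)ᴴ * K i)) * ψ).trace := by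
    intro i
    rw [trace_mul_comm, ← Matrix.mul_assoc, conjTranspose_kronecker, ← mul_kronecker_mul]
    simp
  simp only [this]
  rw [← trace_sum, ← Finset.sum_mul]
  have h2 : ∑ i, (1 : Matrix A A ℂ) ⊗ₖ ((K i)ᴴ * K i) = 1 := by
    rw [← one_kronecker_one, ← hK]
    funext p q
    simp [Matrix.sum_apply, kroneckerMap_apply, Finset.mul_sum]
  rw [h2, one_mul]

lemma ptR_psd {ψ : Matrix (A × A) (A × A) ℂ} (hψ : ψ.PosSemidef) : (ptR ψ).PosSemidef := by
  have : ptR ψ = ∑ k : A, ψ.submatrix (fun i => (i, k)) (fun i => (i, k)) := by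
    funext i j
    simp [ptR, Matrix.sum_apply]
  rw [this]
  exact posSemidef_sum _ fun k _ => hψ.submatrix _

lemma ptR_trace (ψ : Matrix (A × A) (A × A) ℂ) : (ptR ψ).trace = ψ.trace := by
  simp [ptR, trace, Fintype.sum_prod_type]

end channel

/-- I_max(N) = lim_{α→∞} I_α(N), where
I_α(N) = sup_ψ inf_{σ_B} D_α(N(ψ_{RA}) ‖ ψ_R ⊗ σ_B) and
I_max(N) = sup_ψ inf_{σ_B} D_max(N(ψ_{RA}) ‖ ψ_R ⊗ σ_B). -/
theorem iMax_eq_lim_iAlpha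
    {A B ι : Type} [Fintype A] [DecidableEq A] [Nonempty A]
    [Fintype B] [DecidableEq B] [Nonempty B] [Fintype ι]
    (K : ι → Matrix B A ℂ) (hK : ∑ i, (K i)ᴴ * K i = 1) :
    Filter.Tendsto
      (fun α : ℝ =>
        ⨆ ψ : {ψ : Matrix (A × A) (A × A) ℂ // IsPure ψ},
          ⨅ σ : {σ : Matrix B B ℂ // IsDensity σ},
            sandE α (ext (krausMap K) ψ.1) ((ptR ψ.1) ⊗ₖ σ.1))
      Filter.atTop
      (nhds (⨆ ψ : {ψ : Matrix (A × A) (A × A) ℂ // IsPure ψ},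
          ⨅ σ : {σ : Matrix B B ℂ // IsDensity σ},
            dMaxE (ext (krausMap K) ψ.1) ((ptR ψ.1) ⊗ₖ σ.1))) := by
  have hne : ∀ ψ : {ψ : Matrix (A × A) (A × A) ℂ // IsPure ψ}, ext (krausMap K) ψ.1 ≠ 0 := by
    intro ψ h0
    have := ext_trace K hK ψ.1
    rw [h0, ψ.2.1.2] at this
    simp at this
  rw [tendsto_order]
  constructor
  · intro a ha
    obtain ⟨ψ, hψ⟩ := lt_iSup_iff.1 ha
    obtain ⟨r, har, hr⟩ := EReal.lt_iff_exists_real_btwn.1 hψ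
    obtain ⟨r', har', hr'⟩ := EReal.lt_iff_exists_real_btwn.1 har
    have hrr : r' < r := by exact_mod_cast hr'
    obtain ⟨C, hC⟩ := lower_bound (m := B) (ext_psd K ψ.2.1.1) (hne ψ) (ptR_psd ψ.2.1.1)
    have hlin : ∀ᶠ α : ℝ in Filter.atTop, C - r' ≤ α * (r - r') :=
      (Filter.tendsto_id.atTop_mul_const (sub_pos.2 hrr)).eventually_ge_atTop _
    filter_upwards [hlin, Filter.eventually_gt_atTop 1] with α hα hα1
    refine lt_of_lt_of_le har' (le_iSup_of_le ψ (le_iInf fun σ => ?_))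
    by_cases hs : ∀ v, (ptR ψ.1 ⊗ₖ σ.1) *ᵥ v = 0 → ext (krausMap K) ψ.1 *ᵥ v = 0
    · rw [sandE, if_pos (Or.inr hs), EReal.coe_le_coe_iff]
      obtain ⟨σ', hσ', hle⟩ := hC α hα1 σ.1 σ.2 hs
      have h2 := iInf_le (fun σ : {σ : Matrix B B ℂ // IsDensity σ} =>
            dMaxE (ext (krausMap K) ψ.1) ((ptR ψ.1) ⊗ₖ σ.1)) ⟨σ', hσ'⟩
      have h3 := lt_of_lt_of_le hr (h2.trans hle)
      rw [EReal.coe_lt_coe_iff, lt_div_iff₀ (by linarith)] at h3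
      have h4 : (α - 1) * r' ≤ (α - 1) * sandD α (ext (krausMap K) ψ.1) (ptR ψ.1 ⊗ₖ σ.1) := by
        generalize sandD α (ext (krausMap K) ψ.1) (ptR ψ.1 ⊗ₖ σ.1) = D at h3 ⊢
        linarith
      exact le_of_mul_le_mul_left h4 (by linarith)
    · rw [sandE, if_neg]
      · exact le_top
      · rintro (h | h)
        · linarith
        · exact hs h
  · intro b hb
    obtain ⟨r, hr, hrb⟩ := EReal.lt_iff_exists_real_btwn.1 hb
    obtain ⟨r', hrr', hrb'⟩ := EReal.lt_iff_exists_real_btwn.1 hrb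
    have hrr : r < r' := by exact_mod_cast hrr'
    have hlin : ∀ᶠ α : ℝ in Filter.atTop,
        Real.logb 2 (Fintype.card (A × B)) + r' ≤ α * (r' - r) :=
      (Filter.tendsto_id.atTop_mul_const (sub_pos.2 hrr)).eventually_ge_atTop _
    filter_upwards [hlin, Filter.eventually_gt_atTop 1] with α hα hα1
    refine lt_of_le_of_lt (iSup_le fun ψ => ?_) hrb'
    have h1 := lt_of_le_of_lt (le_iSup (fun ψ : {ψ : Matrix (A × A) (A × A) ℂ // IsPure ψ} =>
      ⨅ σ : {σ : Matrix B B ℂ // IsDensity σ},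
            dMaxE (ext (krausMap K) ψ.1) ((ptR ψ.1) ⊗ₖ σ.1)) ψ) hr
    obtain ⟨σ, hσ⟩ := iInf_lt_iff.1 h1
    obtain ⟨_, ⟨l, hl, rfl⟩, hlr⟩ := sInf_lt_iff.1 hσ
    have hlr' : l < r := EReal.coe_lt_coe_iff.1 hlr
    have hω := ptR_psd ψ.2.1.1
    have hp : ((((2 : ℝ) ^ r : ℝ) : ℂ) • (ptR ψ.1 ⊗ₖ σ.1) - ext (krausMap K) ψ.1).PosSemidef :=
      psd_mono (hω.kronecker σ.2.1)
        (Real.rpow_le_rpow_of_exponent_le (by norm_num) hlr'.le) hl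
    obtain ⟨U, a, u1, u2, hωe, ha, hat⟩ := exists_spec hω
    obtain ⟨V, b', v1, v2, hσe, hb', hbt⟩ := exists_spec σ.2.1
    have hb1 : ∑ i, b' i = 1 := by
      rw [σ.2.2] at hbt; exact_mod_cast hbt.symm
    have ha1 : ∑ i, a i = 1 := by
      rw [ptR_trace, ψ.2.1.2] at hat; exact_mod_cast hat.symm
    have hble : ∀ i, b' i ≤ 1 := fun i => hb1 ▸
      Finset.single_le_sum (fun i _ => hb' i) (Finset.mem_univ i)
    have hale : ∀ i, a i ≤ 1 := fun i => ha1 ▸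
      Finset.single_le_sum (fun i _ => ha i) (Finset.mem_univ i)
    have h5 := sandE_le (U := U ⊗ₖ V) (d := fun p => a p.1 * b' p.2) (ext_psd K ψ.2.1.1) (hne ψ)
      (kron_unit' u1 v1) (kron_unit u2 v2) (by rw [hωe, hσe, kron_conj])
      (fun p => mul_nonneg (ha _) (hb' _))
      (fun p => mul_le_one₀ (hale _) (hb' _) (hble _)) hα1 hp
    refine (iInf_le _ σ).trans (h5.trans ?_)
    rw [EReal.coe_le_coe_iff, div_le_iff₀ (by linarith)]
    linarith

end QCh
end
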